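/- arXiv:2109.12741 — 8 statements merged into one kernel-verified Lean document; each statement's English description precedes it below -/
import Mathlib

section
/- Let γ¹ = [[1,0],[0,−1]] and γ² = [[0,1],[1,0]] be 2×2 complex matrices. For every N ≥ 1, all Hermitian matrices H₁, H₂ ∈ M_N(ℂ), and every natural number m, the 2N²×2N² matrix D = γ¹ ⊗ (H₁ ⊗ I_N + I_N ⊗ H₁ᵀ) + γ² ⊗ (H₂ ⊗ I_N + I_N ⊗ H₂ᵀ), built with Kronecker products, satisfies tr(D^{2m+1}) = 0; that is, all odd trace powers of a type (2,0) Dirac operator vanish. -/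
open Matrix Kronecker

/-- The trace of an odd power of a matrix that anticommutes with an invertible matrix vanishes. -/
theorem Matrix.trace_pow_eq_zero_of_odd_of_anticommute {n R : Type*} [Fintype n] [DecidableEq n]
    [CommRing R] [IsAddTorsionFree R] {U V D : Matrix n n R} (hVU : V * U = 1)
    (hUD : U * D = -D * U) {k : ℕ} (hk : Odd k) : (D ^ k).trace = 0 := by
  have hpow : U * D ^ k = -(D ^ k) * U := by
    have h : SemiconjBy U D (-D) := hUD
    simpa only [hk.neg_pow] using (h.pow_right k).eq
  have hUV : U * V = 1 := mul_eq_one_comm.mp hVU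
  refine self_eq_neg.mp ?_
  calc (D ^ k).trace = (V * (U * D ^ k)).trace := by rw [← Matrix.mul_assoc, hVU, Matrix.one_mul]
    _ = (-(D ^ k) * U * V).trace := by rw [hpow, Matrix.trace_mul_comm]
    _ = -(D ^ k).trace := by rw [Matrix.mul_assoc, hUV, Matrix.mul_one, Matrix.trace_neg]

/-- `γ¹ ⊗ A + γ² ⊗ B` anticommutes with `γ¹γ² ⊗ I`. -/
theorem chirality_mul_dirac {n : Type*} [Fintype n] [DecidableEq n] (A B : Matrix n n ℂ) :
    ((!![0, 1; -1, 0] : Matrix (Fin 2) (Fin 2) ℂ) ⊗ₖ (1 : Matrix n n ℂ)) *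
        ((!![1, 0; 0, -1] : Matrix (Fin 2) (Fin 2) ℂ) ⊗ₖ A +
          (!![0, 1; 1, 0] : Matrix (Fin 2) (Fin 2) ℂ) ⊗ₖ B) =
      -((!![1, 0; 0, -1] : Matrix (Fin 2) (Fin 2) ℂ) ⊗ₖ A +
          (!![0, 1; 1, 0] : Matrix (Fin 2) (Fin 2) ℂ) ⊗ₖ B) *
        ((!![0, 1; -1, 0] : Matrix (Fin 2) (Fin 2) ℂ) ⊗ₖ (1 : Matrix n n ℂ)) := by
  rw [Matrix.neg_mul, Matrix.mul_add, Matrix.add_mul]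
  simp only [← Matrix.mul_kronecker_mul, Matrix.one_mul, Matrix.mul_one]
  ext ⟨i, a⟩ ⟨j, b⟩
  fin_cases i <;> fin_cases j <;> simp [Matrix.kroneckerMap_apply]

/-- All odd trace powers of a type (2,0) Dirac operator
`D = γ¹ ⊗ {H₁,·} + γ² ⊗ {H₂,·}` vanish, where `γ¹ = [[1,0],[0,−1]]`,
`γ² = [[0,1],[1,0]]`, the anticommutator `{H,·}` is represented as
`H ⊗ I_N + I_N ⊗ Hᵀ`, and `H₁, H₂` are Hermitian. -/
theorem trace_odd_pow_dirac_type_two_zero (N : ℕ) (hN : 1 ≤ N)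
    (H₁ H₂ : Matrix (Fin N) (Fin N) ℂ)
    (hH₁ : H₁.IsHermitian) (hH₂ : H₂.IsHermitian) (m : ℕ) :
    Matrix.trace
      (((!![1, 0; 0, -1] : Matrix (Fin 2) (Fin 2) ℂ) ⊗ₖ
          (H₁ ⊗ₖ (1 : Matrix (Fin N) (Fin N) ℂ) +
            (1 : Matrix (Fin N) (Fin N) ℂ) ⊗ₖ H₁ᵀ) +
        (!![0, 1; 1, 0] : Matrix (Fin 2) (Fin 2) ℂ) ⊗ₖ
          (H₂ ⊗ₖ (1 : Matrix (Fin N) (Fin N) ℂ) +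
            (1 : Matrix (Fin N) (Fin N) ℂ) ⊗ₖ H₂ᵀ)) ^ (2 * m + 1)) = 0 := by
  refine Matrix.trace_pow_eq_zero_of_odd_of_anticommute
    (V := (!![0, -1; 1, 0] : Matrix (Fin 2) (Fin 2) ℂ) ⊗ₖ 1) ?_
    (chirality_mul_dirac _ _) ⟨m, rfl⟩
  rw [← Matrix.mul_kronecker_mul, Matrix.one_mul]
  simp [← Matrix.one_fin_two]
end

section
/- Let γ¹ = [[1,0],[0,−1]] and γ² = [[0,i],[−i,0]] be 2×2 complex matrices. For every N ≥ 1, all Hermitian matrices H₁, H₂ ∈ M_N(ℂ), and every natural number m, the 2N²×2N² matrix D = γ¹ ⊗ (H₁ ⊗ I_N + I_N ⊗ H₁ᵀ) + γ² ⊗ (H₂ ⊗ I_N − I_N ⊗ H₂ᵀ), built with Kronecker products, satisfies tr(D^{2m+1}) = 0; that is, all odd trace powers of a type (1,1) Dirac operator vanish. -/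
open Matrix Kronecker Complex

/-- Odd powers of a matrix that anticommutes with an involution are traceless. -/
theorem Matrix.trace_odd_pow_eq_zero_of_semiconjBy_neg {n R : Type*} [Fintype n] [DecidableEq n]
    [CommRing R] [NoZeroDivisors R] [CharZero R] {S D : Matrix n n R}
    (hS : S * S = 1) (hSD : SemiconjBy S D (-D)) (m : ℕ) :
    (D ^ (2 * m + 1)).trace = 0 := by
  have hpow : S * D ^ (2 * m + 1) = -D ^ (2 * m + 1) * S := by
    simpa [SemiconjBy, Odd.neg_pow (odd_two_mul_add_one m)] using hSD.pow_right (2 * m + 1)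
  rw [← self_eq_neg]
  calc (D ^ (2 * m + 1)).trace = (S * D ^ (2 * m + 1) * S).trace := by
        rw [Matrix.trace_mul_comm, ← mul_assoc, hS, one_mul]
    _ = -(D ^ (2 * m + 1)).trace := by
        rw [hpow, mul_assoc, hS, mul_one, Matrix.trace_neg]

/-- If `σ` anticommutes with `a`, then `σ ⊗ 1` anticommutes with `a ⊗ b`. -/
theorem Matrix.semiconjBy_kronecker_one_neg {l n R : Type*} [Fintype l] [Fintype n]
    [DecidableEq n] [CommRing R] {σ a : Matrix l l R} (h : SemiconjBy σ a (-a))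
    (b : Matrix n n R) :
    SemiconjBy (σ ⊗ₖ (1 : Matrix n n R)) (a ⊗ₖ b) (-(a ⊗ₖ b)) := by
  have h' : σ * a = -(a * σ) := by simpa [SemiconjBy] using h
  rw [SemiconjBy, neg_mul, ← mul_kronecker_mul, ← mul_kronecker_mul, h', one_mul, mul_one]
  ext
  simp

/-- All odd trace powers of a type (1,1) Dirac operator
`D = γ¹ ⊗ {H₁,·} + γ² ⊗ [H₂,·]` vanish, where `γ¹ = [[1,0],[0,−1]]`,
`γ² = [[0,i],[−i,0]]`, the anticommutator `{H,·}` is represented as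
`H ⊗ I_N + I_N ⊗ Hᵀ`, the commutator `[H,·]` as `H ⊗ I_N − I_N ⊗ Hᵀ`,
and `H₁, H₂` are Hermitian. -/
theorem trace_odd_pow_dirac_type_one_one (N : ℕ) (hN : 1 ≤ N)
    (H₁ H₂ : Matrix (Fin N) (Fin N) ℂ)
    (hH₁ : H₁.IsHermitian) (hH₂ : H₂.IsHermitian) (m : ℕ) :
    Matrix.trace
      (((!![1, 0; 0, -1] : Matrix (Fin 2) (Fin 2) ℂ) ⊗ₖ
          (H₁ ⊗ₖ (1 : Matrix (Fin N) (Fin N) ℂ) +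
            (1 : Matrix (Fin N) (Fin N) ℂ) ⊗ₖ H₁ᵀ) +
        (!![0, Complex.I; -Complex.I, 0] : Matrix (Fin 2) (Fin 2) ℂ) ⊗ₖ
          (H₂ ⊗ₖ (1 : Matrix (Fin N) (Fin N) ℂ) -
            (1 : Matrix (Fin N) (Fin N) ℂ) ⊗ₖ H₂ᵀ)) ^ (2 * m + 1)) = 0 := by
  let σ : Matrix (Fin 2) (Fin 2) ℂ := !![0, 1; 1, 0]
  have hσ : σ * σ = 1 := by simp [σ, one_fin_two]
  refine trace_odd_pow_eq_zero_of_semiconjBy_neg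
    (S := σ ⊗ₖ (1 : Matrix (Fin N × Fin N) (Fin N × Fin N) ℂ)) ?_ ?_ m
  · rw [← mul_kronecker_mul, hσ, one_mul, one_kronecker_one]
  · rw [neg_add]
    exact (semiconjBy_kronecker_one_neg (by simp [SemiconjBy, σ]) _).add_right
      (semiconjBy_kronecker_one_neg (by simp [SemiconjBy, σ]) _)
end

section
/- Let γ¹ = [[−1,0],[0,1]] and γ² = [[0,i],[−i,0]] be 2×2 complex matrices. For every N ≥ 1, all Hermitian matrices H₁, H₂ ∈ M_N(ℂ), and every natural number m, the 2N²×2N² matrix D = γ¹ ⊗ (H₁ ⊗ I_N − I_N ⊗ H₁ᵀ) + γ² ⊗ (H₂ ⊗ I_N − I_N ⊗ H₂ᵀ), built with Kronecker products, satisfies tr(D^{2m+1}) = 0; that is, all odd trace powers of a type (0,2) Dirac operator vanish. -/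
open Matrix Kronecker Complex

/-- If an invertible matrix anticommutes with `D`, all odd powers of `D` are traceless. -/
theorem trace_odd_pow_eq_zero_of_semiconjBy_neg {ι : Type*} [Fintype ι] [DecidableEq ι]
    {U V D : Matrix ι ι ℂ} (hVU : V * U = 1) (h : SemiconjBy U D (-D)) (m : ℕ) :
    (D ^ (2 * m + 1)).trace = 0 := by
  have hpow : U * D ^ (2 * m + 1) = -(D ^ (2 * m + 1) * U) := by
    rw [(h.pow_right (2 * m + 1)).eq, (odd_two_mul_add_one m).neg_pow, neg_mul]
  have hUV : U * V = 1 := mul_eq_one_comm.mp hVU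
  refine self_eq_neg.mp ?_
  calc (D ^ (2 * m + 1)).trace
      = (V * (U * D ^ (2 * m + 1))).trace := by rw [← mul_assoc, hVU, one_mul]
    _ = -(D ^ (2 * m + 1)).trace := by
      rw [hpow, mul_neg, trace_neg, trace_mul_comm, mul_assoc, hUV, mul_one]

/-- Any combination of `γ¹` and `γ²` anticommutes with the chirality `[[0,1],[1,0]]`. -/
theorem semiconjBy_chirality_neg {ι : Type*} [Fintype ι] [DecidableEq ι] (A B : Matrix ι ι ℂ) :
    SemiconjBy ((!![0, 1; 1, 0] : Matrix (Fin 2) (Fin 2) ℂ) ⊗ₖ (1 : Matrix ι ι ℂ))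
      ((!![-1, 0; 0, 1] : Matrix (Fin 2) (Fin 2) ℂ) ⊗ₖ A +
        (!![0, Complex.I; -Complex.I, 0] : Matrix (Fin 2) (Fin 2) ℂ) ⊗ₖ B)
      (-((!![-1, 0; 0, 1] : Matrix (Fin 2) (Fin 2) ℂ) ⊗ₖ A +
        (!![0, Complex.I; -Complex.I, 0] : Matrix (Fin 2) (Fin 2) ℂ) ⊗ₖ B)) := by
  rw [SemiconjBy, neg_mul, mul_add, add_mul]
  simp only [← mul_kronecker_mul, one_mul, mul_one]
  ext ⟨i, j⟩ ⟨k, l⟩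
  fin_cases i <;> fin_cases k <;> simp [kroneckerMap_apply]

/-- All odd trace powers of a type (0,2) Dirac operator
`D = γ¹ ⊗ [H₁,·] + γ² ⊗ [H₂,·]` vanish, where `γ¹ = [[−1,0],[0,1]]`,
`γ² = [[0,i],[−i,0]]`, the commutator `[H,·]` is represented as
`H ⊗ I_N − I_N ⊗ Hᵀ`, and `H₁, H₂` are Hermitian. -/
theorem trace_odd_pow_dirac_type_zero_two (N : ℕ) (hN : 1 ≤ N)
    (H₁ H₂ : Matrix (Fin N) (Fin N) ℂ)
    (hH₁ : H₁.IsHermitian) (hH₂ : H₂.IsHermitian) (m : ℕ) :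
    Matrix.trace
      (((!![-1, 0; 0, 1] : Matrix (Fin 2) (Fin 2) ℂ) ⊗ₖ
          (H₁ ⊗ₖ (1 : Matrix (Fin N) (Fin N) ℂ) -
            (1 : Matrix (Fin N) (Fin N) ℂ) ⊗ₖ H₁ᵀ) +
        (!![0, Complex.I; -Complex.I, 0] : Matrix (Fin 2) (Fin 2) ℂ) ⊗ₖ
          (H₂ ⊗ₖ (1 : Matrix (Fin N) (Fin N) ℂ) -
            (1 : Matrix (Fin N) (Fin N) ℂ) ⊗ₖ H₂ᵀ)) ^ (2 * m + 1)) = 0 := by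
  refine trace_odd_pow_eq_zero_of_semiconjBy_neg
    (V := (!![0, 1; 1, 0] : Matrix (Fin 2) (Fin 2) ℂ) ⊗ₖ 1) ?_ (semiconjBy_chirality_neg _ _) m
  rw [← mul_kronecker_mul, mul_one, mul_fin_two]
  simp [← one_fin_two]
end

section
/- For every natural number m, the m-th moment of the Wigner semicircle density satisfies ∫_{−2}^{2} x^m · (1/(2π))·√(4−x²) dx = c_m, where c_m = (1/(m/2+1))·C(m, m/2) (the Catalan number Cat(m/2)) if m is even, and c_m = 0 if m is odd. -/
open MeasureTheory Real

/-- The `m`-th Catalan-type moment constant: `Cat(m/2)` if `m` is even, `0` otherwise. -/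
noncomputable def semicircleMoment (m : ℕ) : ℝ :=
  if Even m then (catalan (m / 2) : ℝ) else 0

theorem integral_cos_pow_zero_pi_succ_succ (n : ℕ) :
    ∫ x in (0 : ℝ)..π, cos x ^ (n + 2) = (n + 1) / (n + 2) * ∫ x in (0 : ℝ)..π, cos x ^ n := by
  simp [integral_cos_pow]

theorem integral_cos_pow_odd (k : ℕ) : ∫ x in (0 : ℝ)..π, cos x ^ (2 * k + 1) = 0 := by
  induction k with
  | zero => simp
  | succ k ih =>
    rw [show 2 * (k + 1) + 1 = 2 * k + 1 + 2 by ring, integral_cos_pow_zero_pi_succ_succ, ih,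
      mul_zero]

theorem succ_succ_mul_catalan_succ (k : ℕ) :
    (k + 2) * catalan (k + 1) = 2 * (2 * k + 1) * catalan k := by
  have h₀ := succ_mul_catalan_eq_centralBinom k
  have h₁ := succ_mul_catalan_eq_centralBinom (k + 1)
  have h₂ := Nat.succ_mul_centralBinom_succ k
  apply Nat.eq_of_mul_eq_mul_left k.succ_pos
  rw [← h₀, ← h₁] at h₂
  linarith

theorem integral_cos_pow_even (k : ℕ) :
    ∫ x in (0 : ℝ)..π, cos x ^ (2 * k) = π * (k + 1) * catalan k / 4 ^ k := by
  induction k with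
  | zero => simp
  | succ k ih =>
    have h : ((k : ℝ) + 2) * catalan (k + 1) = 2 * (2 * k + 1) * catalan k :=
      mod_cast succ_succ_mul_catalan_succ k
    rw [mul_add_one, integral_cos_pow_zero_pi_succ_succ, ih]
    push_cast
    field_simp
    linear_combination (-2 : ℝ) * 4 ^ k * h

theorem integral_pow_mul_semicircle (m : ℕ) :
    ∫ x in (-2 : ℝ)..2, x ^ m * ((1 / (2 * π)) * Real.sqrt (4 - x ^ 2)) =
      2 ^ (m + 1) / (π * (m + 2)) * ∫ θ in (0 : ℝ)..π, cos θ ^ m := by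
  have hsub := intervalIntegral.integral_comp_mul_deriv (a := π) (b := 0)
    (f := fun θ => 2 * cos θ) (f' := fun θ => 2 * -sin θ)
    (g := fun x => x ^ m * ((1 / (2 * π)) * Real.sqrt (4 - x ^ 2)))
    (fun θ _ => (hasDerivAt_cos θ).const_mul 2) (by fun_prop) (by fun_prop)
  simp only [cos_pi, cos_zero, mul_neg, mul_one] at hsub
  rw [← hsub, intervalIntegral.integral_symm, ← intervalIntegral.integral_neg]
  have hcongr : ∀ θ ∈ Set.uIcc 0 π,
      - -(((fun x : ℝ => x ^ m * ((1 / (2 * π)) * Real.sqrt (4 - x ^ 2))) ∘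
        fun θ => 2 * cos θ) θ * (2 * sin θ)) =
      2 ^ (m + 1) / π * (cos θ ^ m - cos θ ^ (m + 2)) := by
    intro θ hθ
    rw [Set.uIcc_of_le pi_pos.le] at hθ
    have hsin : 0 ≤ sin θ := sin_nonneg_of_mem_Icc hθ
    have hsqrt : Real.sqrt (4 - (2 * cos θ) ^ 2) = 2 * sin θ := by
      rw [show 4 - (2 * cos θ) ^ 2 = (2 * sin θ) ^ 2 by
        linear_combination (-4 : ℝ) * sin_sq_add_cos_sq θ]
      exact Real.sqrt_sq (by positivity)
    simp only [Function.comp_apply, hsqrt]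
    field_simp
    rw [mul_pow, sin_sq]
    ring
  rw [intervalIntegral.integral_congr hcongr, intervalIntegral.integral_const_mul,
    intervalIntegral.integral_sub
      (by apply Continuous.intervalIntegrable; fun_prop)
      (by apply Continuous.intervalIntegrable; fun_prop),
    integral_cos_pow_zero_pi_succ_succ]
  field_simp
  ring

/-- The moments of the Wigner semicircle density:
`∫_{−2}^{2} x^m (1/(2π))√(4−x²) dx = Cat(m/2)` for even `m`, and `0` for odd `m`. -/
theorem wigner_semicircle_moments (m : ℕ) :
    (∫ x in (-2 : ℝ)..2, x ^ m * ((1 / (2 * π)) * Real.sqrt (4 - x ^ 2))) =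
      semicircleMoment m := by
  rw [integral_pow_mul_semicircle, semicircleMoment]
  rcases Nat.even_or_odd' m with ⟨k, rfl | rfl⟩
  · rw [integral_cos_pow_even, if_pos (even_two_mul k), Nat.mul_div_cancel_left k two_pos,
      pow_succ, pow_mul]
    push_cast
    field_simp
    norm_num [mul_comm]
  · rw [integral_cos_pow_odd, if_neg (by simp), mul_zero]
end

section
/- For each N ≥ 1 let λ_N be an additive Haar (Lebesgue) measure on the real vector space of N×N complex Hermitian matrices, and define the Gaussian Dirac-ensemble expectation ⟨f⟩_N = (∫ f(H)·exp(−(N/2)·tr H² − (1/2)·(tr H)²) dλ_N(H)) / (∫ exp(−(N/2)·tr H² − (1/2)·(tr H)²) dλ_N(H)), which is independent of the normalization of λ_N. Let D_H = H ⊗ I_N + I_N ⊗ Hᵀ. Then for every natural number m, lim_{N→∞} (1/N²)·⟨tr(D_H^m)⟩_N = ∑_{j=0}^{m} C(m,j) · c_j · c_{m−j}. -/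
open MeasureTheory Matrix Kronecker Complex Filter Finset Real

noncomputable instance (N : ℕ) :
    MeasurableSpace (selfAdjoint (Matrix (Fin N) (Fin N) ℂ)) := borel _

instance (N : ℕ) : BorelSpace (selfAdjoint (Matrix (Fin N) (Fin N) ℂ)) := ⟨rfl⟩

/-- The Gaussian weight `exp(−(N/2)·tr H² − (1/2)·(tr H)²)` of the type (1,0)
Gaussian Dirac ensemble. -/
noncomputable def gaussWeight (N : ℕ) (H : selfAdjoint (Matrix (Fin N) (Fin N) ℂ)) : ℝ :=
  Real.exp (-((N : ℝ) / 2) * (Matrix.trace ((H : Matrix (Fin N) (Fin N) ℂ) ^ 2)).re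
    - (1 / 2) * ((Matrix.trace (H : Matrix (Fin N) (Fin N) ℂ)).re) ^ 2)

/-- The type (1,0) Dirac operator `D_H = H ⊗ I_N + I_N ⊗ Hᵀ`. -/
noncomputable def diracOp (N : ℕ) (H : selfAdjoint (Matrix (Fin N) (Fin N) ℂ)) :
    Matrix ((Fin N) × (Fin N)) ((Fin N) × (Fin N)) ℂ :=
  (H : Matrix (Fin N) (Fin N) ℂ) ⊗ₖ (1 : Matrix (Fin N) (Fin N) ℂ) +
    (1 : Matrix (Fin N) (Fin N) ℂ) ⊗ₖ (H : Matrix (Fin N) (Fin N) ℂ)ᵀ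

namespace GaussianDirac

attribute [local instance] Matrix.normedAddCommGroup Matrix.normedSpace

variable {N : ℕ}

/-- The space of Hermitian matrices. -/
abbrev Herm (N : ℕ) : AddSubgroup (Matrix (Fin N) (Fin N) ℂ) :=
  selfAdjoint (Matrix (Fin N) (Fin N) ℂ)

noncomputable instance : NormedSpace ℝ (Herm N) where
  norm_smul_le r x := (norm_smul r (x : Matrix (Fin N) (Fin N) ℂ)).le

instance : @BorelSpace (Herm N) PseudoMetricSpace.toUniformSpace.toTopologicalSpace _ := ⟨rfl⟩

instance (μ : Measure (Herm N)) [h : μ.IsAddHaarMeasure] :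
    @Measure.IsAddHaarMeasure (Herm N) _ PseudoMetricSpace.toUniformSpace.toTopologicalSpace _ μ :=
  h

instance : FiniteDimensional ℝ (Herm N) :=
  FiniteDimensional.of_injective (selfAdjoint.submodule ℝ (Matrix (Fin N) (Fin N) ℂ)).subtype
    Subtype.val_injective

/-- The value at `H` of a polynomial in the matrix entries. -/
noncomputable def entryEval (H : Herm N) : MvPolynomial (Fin N × Fin N) ℂ →+* ℂ :=
  MvPolynomial.eval fun p => (H : Matrix (Fin N) (Fin N) ℂ) p.1 p.2

lemma norm_entry_le (H : Herm N) (i j : Fin N) :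
    ‖(H : Matrix (Fin N) (Fin N) ℂ) i j‖ ≤ ‖H‖ :=
  Matrix.norm_entry_le_entrywise_sup_norm (H : Matrix (Fin N) (Fin N) ℂ)

lemma continuous_entry (i j : Fin N) :
    Continuous fun H : Herm N => (H : Matrix (Fin N) (Fin N) ℂ) i j :=
  continuous_subtype_val.matrix_elem i j

lemma continuous_entryEval (p : MvPolynomial (Fin N × Fin N) ℂ) :
    Continuous fun H : Herm N => entryEval H p := by
  refine (MvPolynomial.continuous_eval p).comp ?_
  exact continuous_pi fun q => continuous_entry q.1 q.2

lemma exists_norm_entryEval_le (p : MvPolynomial (Fin N × Fin N) ℂ) :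
    ∃ (C : ℝ) (k : ℕ), 0 ≤ C ∧ ∀ H : Herm N, ‖entryEval H p‖ ≤ C * (1 + ‖H‖) ^ k := by
  induction p using MvPolynomial.induction_on with
  | C a => exact ⟨‖a‖, 0, norm_nonneg _, fun H => by simp [entryEval]⟩
  | add p q hp hq =>
    obtain ⟨C, k, hC, h⟩ := hp
    obtain ⟨D, l, hD, h'⟩ := hq
    refine ⟨C + D, k + l, by positivity, fun H => ?_⟩
    have h1 : (1 : ℝ) ≤ 1 + ‖H‖ := by linarith [norm_nonneg H]
    rw [map_add, add_mul]
    refine (norm_add_le _ _).trans (add_le_add ((h H).trans ?_) ((h' H).trans ?_)) <;>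
    · gcongr
      · omega
  | mul_X p i hp =>
    obtain ⟨C, k, hC, h⟩ := hp
    refine ⟨C, k + 1, hC, fun H => ?_⟩
    have h2 : ‖entryEval H (MvPolynomial.X i)‖ ≤ 1 + ‖H‖ := by
      simpa [entryEval] using (norm_entry_le H i.1 i.2).trans (le_add_of_nonneg_left zero_le_one)
    rw [map_mul, norm_mul, pow_succ, ← mul_assoc]
    exact mul_le_mul (h H) h2 (norm_nonneg _) (by positivity)

lemma re_trace_sq (H : Herm N) :
    (Matrix.trace ((H : Matrix (Fin N) (Fin N) ℂ) ^ 2)).re =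
      ∑ i, ∑ j, ‖(H : Matrix (Fin N) (Fin N) ℂ) i j‖ ^ 2 := by
  have hH : (H : Matrix (Fin N) (Fin N) ℂ).IsHermitian := H.2
  simp only [pow_two, Matrix.trace, Matrix.diag, Matrix.mul_apply, Complex.re_sum]
  refine Finset.sum_congr rfl fun i _ => Finset.sum_congr rfl fun j _ => ?_
  rw [← hH.apply j i, Complex.star_def, Complex.mul_conj, Complex.ofReal_re,
    Complex.normSq_eq_norm_sq, pow_two]

lemma norm_sq_le_re_trace_sq (H : Herm N) :
    ‖H‖ ^ 2 ≤ (Matrix.trace ((H : Matrix (Fin N) (Fin N) ℂ) ^ 2)).re := by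
  set S := (Matrix.trace ((H : Matrix (Fin N) (Fin N) ℂ) ^ 2)).re with hS
  have h0 : 0 ≤ S := by rw [hS, re_trace_sq]; positivity
  have : ‖H‖ ≤ √S := by
    refine (Matrix.norm_le_iff (Real.sqrt_nonneg _)).2 fun i j => Real.le_sqrt_of_sq_le ?_
    rw [hS, re_trace_sq]
    refine le_trans ?_ (Finset.single_le_sum (f := fun i =>
      ∑ j, ‖(H : Matrix (Fin N) (Fin N) ℂ) i j‖ ^ 2) (fun _ _ => by positivity)
      (Finset.mem_univ i))
    exact Finset.single_le_sum (f := fun j => ‖(H : Matrix (Fin N) (Fin N) ℂ) i j‖ ^ 2)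
      (fun _ _ => by positivity) (Finset.mem_univ j)
  calc ‖H‖ ^ 2 ≤ √S ^ 2 := by gcongr
    _ = S := Real.sq_sqrt h0

lemma continuous_gaussWeight : Continuous (gaussWeight N) := by
  have h : Continuous fun H : Herm N => (H : Matrix (Fin N) (Fin N) ℂ) := continuous_subtype_val
  unfold gaussWeight
  have h1 := (h.pow 2).matrix_trace
  have h2 := h.matrix_trace
  fun_prop

lemma gaussWeight_le (hN : 1 ≤ N) (H : Herm N) :
    gaussWeight N H ≤ Real.exp (3 / 2) * Real.exp (-(1 + ‖H‖)) := by
  rw [gaussWeight, ← Real.exp_add, Real.exp_le_exp]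
  have h1 := norm_sq_le_re_trace_sq H
  have h2 : (1 : ℝ) ≤ N := by exact_mod_cast hN
  nlinarith [sq_nonneg (‖H‖ - 1), sq_nonneg (Matrix.trace (H : Matrix (Fin N) (Fin N) ℂ)).re,
    sq_nonneg ‖H‖]

lemma integrable_entryEval_mul_gaussWeight (hN : 1 ≤ N) (μ : Measure (Herm N))
    [μ.IsAddHaarMeasure] (p : MvPolynomial (Fin N × Fin N) ℂ) :
    Integrable (fun H => entryEval H p * (gaussWeight N H : ℂ)) μ := by
  obtain ⟨C, k, hC, h⟩ := exists_norm_entryEval_le p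
  set r : ℕ := Module.finrank ℝ (Herm N) + 1
  have hint : Integrable (fun H : Herm N => (1 + ‖H‖) ^ (-(r : ℝ))) μ :=
    integrable_one_add_norm (by simp [r])
  refine (hint.const_mul (C * Real.exp (3 / 2) * (k + r).factorial)).mono'
    ((continuous_entryEval p).mul
      (Complex.continuous_ofReal.comp continuous_gaussWeight)).aestronglyMeasurable
    (Eventually.of_forall fun H => ?_)
  have hpos : 0 < 1 + ‖H‖ := by positivity
  have hfac := Real.pow_div_factorial_le_exp (1 + ‖H‖) hpos.le (k + r)
  rw [div_le_iff₀ (by positivity)] at hfac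
  have hw0 : 0 ≤ gaussWeight N H := (Real.exp_pos _).le
  rw [norm_mul, Complex.norm_real, Real.norm_of_nonneg hw0, Real.rpow_neg hpos.le,
    Real.rpow_natCast]
  calc ‖entryEval H p‖ * gaussWeight N H
      ≤ (C * (1 + ‖H‖) ^ k) * (Real.exp (3 / 2) * Real.exp (-(1 + ‖H‖))) :=
        mul_le_mul (h H) (gaussWeight_le hN H) hw0 (by positivity)
    _ = C * Real.exp (3 / 2) * ((1 + ‖H‖) ^ (k + r) * Real.exp (-(1 + ‖H‖))) *
          ((1 + ‖H‖) ^ r)⁻¹ := by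
        rw [pow_add]; field_simp
    _ ≤ C * Real.exp (3 / 2) * (k + r).factorial * ((1 + ‖H‖) ^ r)⁻¹ := by
        rw [mul_assoc (C * _)]
        rw [mul_assoc (C * _)]
        gcongr
        rw [Real.exp_neg, ← div_eq_mul_inv, div_le_iff₀ (Real.exp_pos _)]
        linarith

lemma hasLineDerivAt_entryEval (B H : Herm N) (p : MvPolynomial (Fin N × Fin N) ℂ) :
    HasLineDerivAt ℝ (fun H : Herm N => entryEval H p)
      (∑ q, (B : Matrix (Fin N) (Fin N) ℂ) q.1 q.2 * entryEval H (MvPolynomial.pderiv q p))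
      H B := by
  unfold HasLineDerivAt
  induction p using MvPolynomial.induction_on with
  | C a => simpa [entryEval] using hasDerivAt_const (0 : ℝ) a
  | add p q hp hq =>
    simp only [map_add, mul_add, Finset.sum_add_distrib]
    exact hp.add hq
  | mul_X p i hp =>
    have hX : HasDerivAt (fun t : ℝ => entryEval (H + t • B) (MvPolynomial.X i))
        ((B : Matrix (Fin N) (Fin N) ℂ) i.1 i.2) 0 := by
      have h1 : HasDerivAt (fun t : ℝ => (t : ℂ) * (B : Matrix (Fin N) (Fin N) ℂ) i.1 i.2)
          (1 * (B : Matrix (Fin N) (Fin N) ℂ) i.1 i.2) 0 :=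
        (Complex.ofRealCLM.hasDerivAt (x := (0 : ℝ))).mul_const _
      simpa [entryEval] using h1.const_add ((H : Matrix (Fin N) (Fin N) ℂ) i.1 i.2)
    simp only [map_mul]
    convert! hp.mul hX using 1
    simp only [Derivation.leibniz, MvPolynomial.pderiv_X, smul_eq_mul, map_add, map_mul, mul_add,
      Finset.sum_add_distrib, zero_smul, add_zero]
    rw [add_comm]
    congr 1
    · rw [Finset.sum_mul]
      exact Finset.sum_congr rfl fun q _ => by ring
    · rw [Finset.sum_eq_single i]
      · simp [mul_comm]
      · intro q _ hq
        simp [hq.symm]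
      · simp

/-- The logarithmic derivative of the Gaussian weight along `E_{ij}`, up to sign. -/
noncomputable def potentialDeriv (q : Fin N × Fin N) : MvPolynomial (Fin N × Fin N) ℂ :=
  (N : MvPolynomial (Fin N × Fin N) ℂ) * MvPolynomial.X (q.2, q.1) +
    (if q.1 = q.2 then 1 else 0) * ∑ k, MvPolynomial.X (k, k)

lemma sum_mul_entryEval_potentialDeriv (B H : Herm N) :
    ∑ q, (B : Matrix (Fin N) (Fin N) ℂ) q.1 q.2 * entryEval H (potentialDeriv q) =
      N * Matrix.trace ((H : Matrix (Fin N) (Fin N) ℂ) * (B : Matrix (Fin N) (Fin N) ℂ)) +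
      Matrix.trace (H : Matrix (Fin N) (Fin N) ℂ) *
        Matrix.trace (B : Matrix (Fin N) (Fin N) ℂ) := by
  simp only [potentialDeriv, entryEval, map_add, map_mul, map_natCast, MvPolynomial.eval_X,
    map_sum, mul_add, Finset.sum_add_distrib, Fintype.sum_prod_type]
  congr 1
  · simp only [Matrix.trace, Matrix.diag, Matrix.mul_apply, Finset.mul_sum]
    rw [Finset.sum_comm]
    exact Finset.sum_congr rfl fun i _ => Finset.sum_congr rfl fun j _ => by ring
  · rw [Matrix.trace, Matrix.trace, Finset.mul_sum]
    refine Finset.sum_congr rfl fun i _ => ?_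
    rw [Finset.sum_eq_single i]
    · simp [mul_comm]
    · intro j _ hj; simp [hj.symm]
    · simp

lemma im_trace_mul (A B : Herm N) :
    (Matrix.trace ((A : Matrix (Fin N) (Fin N) ℂ) * (B : Matrix (Fin N) (Fin N) ℂ))).im = 0 := by
  have hA : (A : Matrix (Fin N) (Fin N) ℂ)ᴴ = A := A.2
  have hB : (B : Matrix (Fin N) (Fin N) ℂ)ᴴ = B := B.2
  rw [← Complex.conj_eq_iff_im, ← Complex.star_def, ← Matrix.trace_conjTranspose,
    Matrix.conjTranspose_mul, hA, hB, Matrix.trace_mul_comm]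

lemma im_trace (A : Herm N) : (Matrix.trace (A : Matrix (Fin N) (Fin N) ℂ)).im = 0 := by
  simpa using im_trace_mul A 1

lemma hasLineDerivAt_gaussWeight (B H : Herm N) :
    HasLineDerivAt ℝ (fun H : Herm N => (gaussWeight N H : ℂ))
      (-(∑ q, (B : Matrix (Fin N) (Fin N) ℂ) q.1 q.2 * entryEval H (potentialDeriv q)) *
        (gaussWeight N H : ℂ)) H B := by
  rw [sum_mul_entryEval_potentialDeriv]
  have hreal : (N * Matrix.trace ((H : Matrix (Fin N) (Fin N) ℂ) * (B : Matrix (Fin N) (Fin N) ℂ)) +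
      Matrix.trace (H : Matrix (Fin N) (Fin N) ℂ) *
        Matrix.trace (B : Matrix (Fin N) (Fin N) ℂ) : ℂ) =
      ((N * (Matrix.trace ((H : Matrix (Fin N) (Fin N) ℂ) *
        (B : Matrix (Fin N) (Fin N) ℂ))).re + (Matrix.trace (H : Matrix (Fin N) (Fin N) ℂ)).re *
        (Matrix.trace (B : Matrix (Fin N) (Fin N) ℂ)).re : ℝ) : ℂ) := by
    apply Complex.ext <;> simp [im_trace_mul, im_trace]
  rw [hreal, ← Complex.ofReal_neg, ← Complex.ofReal_mul]
  refine HasDerivAt.ofReal_comp (f := fun t : ℝ => gaussWeight N (H + t • B)) ?_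
  set a := (Matrix.trace ((H : Matrix (Fin N) (Fin N) ℂ) ^ 2)).re with ha
  set b := (Matrix.trace ((H : Matrix (Fin N) (Fin N) ℂ) * (B : Matrix (Fin N) (Fin N) ℂ))).re
    with hb
  set c := (Matrix.trace ((B : Matrix (Fin N) (Fin N) ℂ) ^ 2)).re with hc
  set d := (Matrix.trace (H : Matrix (Fin N) (Fin N) ℂ)).re with hd
  set e := (Matrix.trace (B : Matrix (Fin N) (Fin N) ℂ)).re with he
  have hexp (t : ℝ) : gaussWeight N (H + t • B) =
      Real.exp (-((N : ℝ) / 2) * (a + 2 * b * t + c * t ^ 2) - (1 / 2) * (d + e * t) ^ 2) := by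
    have h1 : (Matrix.trace (((H + t • B : Herm N) : Matrix (Fin N) (Fin N) ℂ) ^ 2)).re =
        a + 2 * b * t + c * t ^ 2 := by
      simp only [ha, hb, hc, pow_two, AddSubgroup.coe_add, selfAdjoint.val_smul, add_mul, mul_add,
        Matrix.trace_add, Matrix.smul_mul, Matrix.mul_smul, Matrix.trace_smul, Complex.add_re,
        Complex.smul_re, smul_eq_mul,
        Matrix.trace_mul_comm (B : Matrix (Fin N) (Fin N) ℂ) (H : Matrix (Fin N) (Fin N) ℂ)]
      ring
    have h2 : (Matrix.trace ((H + t • B : Herm N) : Matrix (Fin N) (Fin N) ℂ)).re = d + e * t := by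
      simp only [hd, he, AddSubgroup.coe_add, selfAdjoint.val_smul, Matrix.trace_add,
        Matrix.trace_smul, Complex.add_re, Complex.smul_re, smul_eq_mul]
      ring
    rw [gaussWeight, h1, h2]
  have h0 : gaussWeight N H = Real.exp (-((N : ℝ) / 2) * a - (1 / 2) * d ^ 2) := rfl
  simp only [hexp, h0]
  have hid := hasDerivAt_id (0 : ℝ)
  have hD := (((((hid.const_mul (2 * b)).const_add a).add ((hid.pow 2).const_mul c)).const_mul
    (-((N : ℝ) / 2))).sub ((((hid.const_mul e).const_add d).pow 2).const_mul (1 / 2))).exp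
  convert! hD using 1
  simp
  ring

lemma integral_pderiv_mul_gaussWeight (hN : 1 ≤ N) (μ : Measure (Herm N))
    [μ.IsAddHaarMeasure] (p : MvPolynomial (Fin N × Fin N) ℂ) (q : Fin N × Fin N) :
    ∫ H, entryEval H (MvPolynomial.pderiv q p) * (gaussWeight N H : ℂ) ∂μ =
      ∫ H, entryEval H (potentialDeriv q * p) * (gaussWeight N H : ℂ) ∂μ := by
  have hi := integrable_entryEval_mul_gaussWeight hN μ
  set α : Fin N × Fin N → ℂ := fun q =>
    ∫ H, entryEval H (MvPolynomial.pderiv q p) * (gaussWeight N H : ℂ) ∂μ -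
      ∫ H, entryEval H (potentialDeriv q * p) * (gaussWeight N H : ℂ) ∂μ with hα
  have hherm (B : Herm N) : ∑ q, (B : Matrix (Fin N) (Fin N) ℂ) q.1 q.2 * α q = 0 := by
    have e1 : (fun H : Herm N => entryEval H p * (-(∑ q, (B : Matrix (Fin N) (Fin N) ℂ) q.1 q.2 *
        entryEval H (potentialDeriv q)) * (gaussWeight N H : ℂ))) = fun H =>
        -∑ q, (B : Matrix (Fin N) (Fin N) ℂ) q.1 q.2 *
          (entryEval H (potentialDeriv q * p) * (gaussWeight N H : ℂ)) := by
      ext H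
      rw [neg_mul, mul_neg, Finset.sum_mul, Finset.mul_sum]
      congr 1
      exact Finset.sum_congr rfl fun q _ => by rw [map_mul]; ring
    have e2 : (fun H : Herm N => (∑ q, (B : Matrix (Fin N) (Fin N) ℂ) q.1 q.2 *
        entryEval H (MvPolynomial.pderiv q p)) * (gaussWeight N H : ℂ)) = fun H =>
        ∑ q, (B : Matrix (Fin N) (Fin N) ℂ) q.1 q.2 *
          (entryEval H (MvPolynomial.pderiv q p) * (gaussWeight N H : ℂ)) := by
      ext H
      rw [Finset.sum_mul]
      exact Finset.sum_congr rfl fun q _ => by ring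
    have hibp := integral_bilinear_hasLineDerivAt_right_eq_neg_left_of_integrable (μ := μ)
      (B := ContinuousLinearMap.mul ℝ ℂ) (v := B)
      (f := fun H : Herm N => entryEval H p)
      (f' := fun H => ∑ q, (B : Matrix (Fin N) (Fin N) ℂ) q.1 q.2 *
        entryEval H (MvPolynomial.pderiv q p))
      (g := fun H : Herm N => (gaussWeight N H : ℂ))
      (g' := fun H => -(∑ q, (B : Matrix (Fin N) (Fin N) ℂ) q.1 q.2 *
        entryEval H (potentialDeriv q)) * (gaussWeight N H : ℂ))
      (by
        simp only [ContinuousLinearMap.mul_apply', e2]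
        exact integrable_finsetSum _ fun q _ => (hi _).const_mul _)
      (by
        simp only [ContinuousLinearMap.mul_apply', e1]
        exact (integrable_finsetSum _ fun q _ => (hi _).const_mul _).neg)
      (hi p) (fun H _ => hasLineDerivAt_entryEval B H p)
      (fun H _ => hasLineDerivAt_gaussWeight B H)
    simp only [ContinuousLinearMap.mul_apply', e1, e2] at hibp
    rw [integral_neg, neg_inj, integral_finsetSum _ fun q _ => (hi _).const_mul _,
      integral_finsetSum _ fun q _ => (hi _).const_mul _] at hibp
    simp only [integral_const_mul] at hibp
    simp only [hα, mul_sub, Finset.sum_sub_distrib, hibp, sub_self]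
  have hall (M : Matrix (Fin N) (Fin N) ℂ) : ∑ q, M q.1 q.2 * α q = 0 := by
    have h1 := hherm (realPart M)
    have h2 := hherm (imaginaryPart M)
    have h3 (q : Fin N × Fin N) : M q.1 q.2 =
        (realPart M : Matrix (Fin N) (Fin N) ℂ) q.1 q.2 +
          Complex.I * (imaginaryPart M : Matrix (Fin N) (Fin N) ℂ) q.1 q.2 := by
      conv_lhs => rw [← realPart_add_I_smul_imaginaryPart M]
      rfl
    simp only [h3, add_mul, mul_assoc, Finset.sum_add_distrib, ← Finset.mul_sum, h1, h2]
    simp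
  have := hall (Matrix.single q.1 q.2 1)
  rw [Finset.sum_eq_single q] at this
  · simpa [hα, sub_eq_zero] using this
  · intro r _ hr
    rw [Matrix.single_apply_of_ne, zero_mul]
    rintro ⟨h, h'⟩
    exact hr (Prod.ext h.symm h'.symm)
  · simp

section Algebra

open MvPolynomial

/-- The polynomial `tr H^k` in the matrix entries. -/
noncomputable def tracePow (N k : ℕ) : MvPolynomial (Fin N × Fin N) ℂ :=
  Matrix.trace (Matrix.mvPolynomialX (Fin N) (Fin N) ℂ ^ k)

lemma entryEval_tracePow (H : Herm N) (k : ℕ) :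
    entryEval H (tracePow N k) = Matrix.trace ((H : Matrix (Fin N) (Fin N) ℂ) ^ k) := by
  rw [tracePow, entryEval, AddMonoidHom.map_trace, ← RingHom.mapMatrix_apply, map_pow,
    Matrix.mvPolynomialX_mapMatrix_eval]

lemma pderiv_mvPolynomialX_pow_succ (k : ℕ) (q : Fin N × Fin N) (r s : Fin N) :
    pderiv q ((Matrix.mvPolynomialX (Fin N) (Fin N) ℂ ^ (k + 1)) r s) =
      ∑ ab ∈ antidiagonal k, (Matrix.mvPolynomialX (Fin N) (Fin N) ℂ ^ ab.1) r q.1 *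
        (Matrix.mvPolynomialX (Fin N) (Fin N) ℂ ^ ab.2) q.2 s := by
  set X := Matrix.mvPolynomialX (Fin N) (Fin N) ℂ with hX
  have hone (r s : Fin N) : pderiv q (X r s) = (1 : Matrix (Fin N) (Fin N) _) r q.1 *
      (1 : Matrix (Fin N) (Fin N) _) q.2 s := by
    rw [hX, Matrix.mvPolynomialX_apply, pderiv_X, Pi.single_apply, Matrix.one_apply,
      Matrix.one_apply]
    by_cases h1 : r = q.1 <;> by_cases h2 : q.2 = s <;> simp [Prod.ext_iff, h1, h2, Ne.symm]
  induction k generalizing r s with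
  | zero => simp [hone]
  | succ k ih =>
    rw [pow_succ, Matrix.mul_apply, map_sum, Finset.Nat.sum_antidiagonal_succ']
    simp only [pderiv_mul, ih, hone, Finset.sum_add_distrib, pow_zero]
    rw [add_comm]
    congr 1
    · simp only [← mul_assoc, ← Finset.sum_mul]
      rw [← Matrix.mul_apply, mul_one]
    · simp only [Finset.sum_mul]
      rw [Finset.sum_comm]
      refine Finset.sum_congr rfl fun ab _ => ?_
      rw [pow_succ, Matrix.mul_apply, Finset.mul_sum]
      exact Finset.sum_congr rfl fun _ _ => mul_assoc _ _ _

/-- The derivation `∑_{ij} (H^k)_{ij} ∂_{ij}`. -/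
noncomputable def powDeriv (N k : ℕ) :
    Derivation ℂ (MvPolynomial (Fin N × Fin N) ℂ) (MvPolynomial (Fin N × Fin N) ℂ) :=
  ∑ q : Fin N × Fin N, (Matrix.mvPolynomialX (Fin N) (Fin N) ℂ ^ k) q.1 q.2 • pderiv q

lemma powDeriv_apply (k : ℕ) (p : MvPolynomial (Fin N × Fin N) ℂ) :
    powDeriv N k p =
      ∑ q : Fin N × Fin N, (Matrix.mvPolynomialX (Fin N) (Fin N) ℂ ^ k) q.1 q.2 * pderiv q p := by
  rw [powDeriv, ← Derivation.coeFnAddMonoidHom_apply, map_sum, Finset.sum_apply]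
  rfl

lemma powDeriv_tracePow (k l : ℕ) :
    powDeriv N k (tracePow N l) = (l : MvPolynomial (Fin N × Fin N) ℂ) * tracePow N (k + l - 1) := by
  cases l with
  | zero =>
    have h : tracePow N 0 = ((N : ℕ) : MvPolynomial (Fin N × Fin N) ℂ) := by simp [tracePow]
    rw [h]
    simp
  | succ l =>
    set X := Matrix.mvPolynomialX (Fin N) (Fin N) ℂ with hX
    have h (q : Fin N × Fin N) : pderiv q (tracePow N (l + 1)) =
        ((l + 1 : ℕ) : MvPolynomial (Fin N × Fin N) ℂ) * (X ^ l) q.2 q.1 := by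
      simp only [tracePow, Matrix.trace, Matrix.diag, map_sum, pderiv_mvPolynomialX_pow_succ]
      rw [Finset.sum_comm, Finset.sum_congr rfl fun ab hab => ?_, Finset.sum_const,
        Finset.Nat.card_antidiagonal, nsmul_eq_mul]
      rw [← HasAntidiagonal.mem_antidiagonal.1 hab, add_comm ab.1, pow_add, Matrix.mul_apply]
      exact Finset.sum_congr rfl fun _ _ => mul_comm _ _
    rw [powDeriv_apply]
    simp only [h, Nat.add_sub_cancel, ← add_assoc, ← hX]
    rw [tracePow, pow_add, Matrix.trace, Finset.mul_sum, Fintype.sum_prod_type]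
    refine Finset.sum_congr rfl fun i _ => ?_
    rw [Matrix.diag, Matrix.mul_apply, Finset.mul_sum]
    exact Finset.sum_congr rfl fun _ _ => mul_left_comm _ _ _

lemma sum_pderiv_mvPolynomialX_pow (k : ℕ) :
    ∑ q : Fin N × Fin N, pderiv q ((Matrix.mvPolynomialX (Fin N) (Fin N) ℂ ^ (k + 1)) q.1 q.2) =
      ∑ ab ∈ antidiagonal k, tracePow N ab.1 * tracePow N ab.2 := by
  simp only [pderiv_mvPolynomialX_pow_succ]
  rw [Finset.sum_comm]
  refine Finset.sum_congr rfl fun ab _ => ?_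
  simp only [tracePow, Matrix.trace, Matrix.diag, Finset.sum_mul_sum, Fintype.sum_prod_type]

lemma sum_potentialDeriv_mul_mvPolynomialX_pow (k : ℕ) :
    ∑ q : Fin N × Fin N, potentialDeriv q *
      (Matrix.mvPolynomialX (Fin N) (Fin N) ℂ ^ k) q.1 q.2 =
      (N : MvPolynomial (Fin N × Fin N) ℂ) * tracePow N (k + 1) +
        tracePow N 1 * tracePow N k := by
  simp only [potentialDeriv, add_mul, Finset.sum_add_distrib, Fintype.sum_prod_type]
  congr 1
  · rw [tracePow, pow_succ, Matrix.trace, Finset.mul_sum]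
    refine Finset.sum_congr rfl fun i _ => ?_
    rw [Matrix.diag, Matrix.mul_apply, Finset.mul_sum]
    refine Finset.sum_congr rfl fun j _ => ?_
    rw [Matrix.mvPolynomialX_apply]
    ring
  · simp only [tracePow, pow_one, Matrix.trace, Matrix.diag, Matrix.mvPolynomialX_apply]
    rw [Finset.mul_sum]
    refine Finset.sum_congr rfl fun i _ => ?_
    rw [Finset.sum_eq_single i]
    · simp
    · intro j _ hj
      simp [hj.symm]
    · simp

end Algebra

/-- `∑_i l_i φ(l with l_i replaced by k + l_i - 1)`, the combinatorial form of `powDeriv` acting on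
a product of traces of powers. -/
def mergeSum {A : Type*} [Semiring A] (k : ℕ) : (List ℕ → A) → List ℕ → A
  | _, [] => 0
  | φ, a :: l => (a : A) * φ ((k + a - 1) :: l) + mergeSum k (fun l' => φ (a :: l')) l

lemma mul_mergeSum {A : Type*} [CommSemiring A] (k : ℕ) (c : A) (φ : List ℕ → A) (l : List ℕ) :
    c * mergeSum k φ l = mergeSum k (fun l' => c * φ l') l := by
  induction l generalizing φ with
  | nil => simp [mergeSum]
  | cons a l ih => simp only [mergeSum, mul_add, ih, mul_left_comm]

lemma map_mergeSum {A : Type*} [CommRing A] [Algebra ℂ A] (L : A →ₗ[ℂ] ℂ) (k : ℕ)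
    (φ : List ℕ → A) (l : List ℕ) :
    L (mergeSum k φ l) = mergeSum k (fun l' => L (φ l')) l := by
  induction l generalizing φ with
  | nil => simp [mergeSum]
  | cons a l ih =>
    simp only [mergeSum, map_add, ih]
    rw [← nsmul_eq_mul, map_nsmul, nsmul_eq_mul]

lemma exists_tendsto_mergeSum (k : ℕ) (M : ℕ → List ℕ → ℂ) (l : List ℕ)
    (h : ∀ l' : List ℕ, l'.sum + 1 = k + l.sum → ∃ c, Tendsto (fun n => M n l') atTop (nhds c)) :
    ∃ c, Tendsto (fun n => mergeSum k (M n) l) atTop (nhds c) := by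
  induction l generalizing M with
  | nil => exact ⟨0, tendsto_const_nhds⟩
  | cons a l ih =>
    obtain ⟨c, hc⟩ := ih (fun n l' => M n (a :: l')) fun l' hl' => h _ (by simp; omega)
    rcases Nat.eq_zero_or_pos a with rfl | ha
    · exact ⟨c, by simpa [mergeSum] using hc⟩
    · obtain ⟨d, hd⟩ := h ((k + a - 1) :: l) (by simp; omega)
      exact ⟨a * d + c, (hd.const_mul _).add hc⟩

lemma semicircleMoment_zero : semicircleMoment 0 = 1 := by simp [semicircleMoment]

lemma semicircleMoment_one : semicircleMoment 1 = 0 := by simp [semicircleMoment]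

lemma semicircleMoment_add_two (k : ℕ) :
    semicircleMoment (k + 2) =
      ∑ ab ∈ antidiagonal k, semicircleMoment ab.1 * semicircleMoment ab.2 := by
  rcases Nat.even_or_odd' k with ⟨n, rfl | rfl⟩
  · have h : (2 * n + 2) / 2 = n + 1 := by omega
    rw [semicircleMoment, if_pos (by grind), h, catalan_succ']
    push_cast
    refine Finset.sum_of_injOn (fun ab => (2 * ab.1, 2 * ab.2)) ?_ ?_ ?_ ?_
    · rintro ⟨a, b⟩ - ⟨c, d⟩ - h
      simpa using h
    · rintro ⟨a, b⟩ h
      simp only [Finset.mem_coe, HasAntidiagonal.mem_antidiagonal] at h ⊢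
      omega
    · rintro ⟨a, b⟩ hab hn
      rw [HasAntidiagonal.mem_antidiagonal] at hab
      by_cases ha : Even a
      · exfalso
        obtain ⟨c, rfl⟩ := ha
        refine hn ⟨(c, n - c), ?_, ?_⟩
        · simp only [Finset.mem_coe, HasAntidiagonal.mem_antidiagonal]; omega
        · simp only [Prod.mk.injEq]; omega
      · simp [semicircleMoment, ha]
    · rintro ⟨a, b⟩ -
      simp [semicircleMoment]
  · rw [semicircleMoment, if_neg (by grind)]
    refine (Finset.sum_eq_zero fun ab hab => ?_).symm
    rw [HasAntidiagonal.mem_antidiagonal] at hab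
    by_cases ha : Even ab.1
    · have hb : ¬ Even ab.2 := by grind
      simp [semicircleMoment, hb]
    · simp [semicircleMoment, ha]

/-- Solutions of the loop equations with a vanishing connected term converge to products of
semicircle moments. -/
theorem tendsto_of_loop_equations (M : ℕ → List ℕ → ℂ) (ε : ℕ → ℂ)
    (hε : Tendsto ε atTop (nhds 0)) (hnil : ∀ n, M n [] = 1)
    (hzero : ∀ n l, M n (0 :: l) = M n l)
    (hperm : ∀ n l l', l.Perm l' → M n l = M n l')
    (hone : ∀ n l, 2 * M n (1 :: l) = ε n * mergeSum 0 (M n) l)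
    (hloop : ∀ n k l, M n ((k + 2) :: l) + M n (1 :: (k + 1) :: l) =
      ∑ ab ∈ antidiagonal k, M n (ab.1 :: ab.2 :: l) + ε n * mergeSum (k + 1) (M n) l)
    (l : List ℕ) :
    Tendsto (fun n => M n l) atTop
      (nhds ((l.map fun k => (semicircleMoment k : ℂ)).prod)) := by
  induction hd : l.sum using Nat.strong_induction_on generalizing l with
  | _ d ih =>
  have hsmall (k : ℕ) (l : List ℕ) (h : k + l.sum < d + 1) :
      Tendsto (fun n => ε n * mergeSum k (M n) l) atTop (nhds 0) := by
    obtain ⟨c, hc⟩ := exists_tendsto_mergeSum k M l fun l' hl' =>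
      ⟨_, ih l'.sum (by omega) l' rfl⟩
    simpa using hε.mul hc
  have hlimone (l : List ℕ) (h : l.sum < d + 1) :
      Tendsto (fun n => M n (1 :: l)) atTop (nhds 0) := by
    have := (hsmall 0 l (by omega)).const_mul (1 / 2)
    rw [mul_zero] at this
    refine this.congr fun n => ?_
    rw [← hone]
    ring
  by_cases hl : ∃ a ∈ l, a ≠ 0
  · obtain ⟨a, hal, ha⟩ := hl
    have hp := List.perm_cons_erase hal
    rw [(hp.map _).prod_eq]
    simp only [hperm _ _ _ hp]
    have hsum := hp.sum_eq
    rw [List.sum_cons] at hsum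
    generalize l.erase a = r at hsum
    rw [List.map_cons, List.prod_cons]
    match a, ha with
    | 1, _ =>
      rw [semicircleMoment_one, Complex.ofReal_zero, zero_mul]
      exact hlimone r (by omega)
    | k + 2, _ =>
      rw [semicircleMoment_add_two]
      have h1 := hlimone ((k + 1) :: r) (by simp; omega)
      have h2 := hsmall (k + 1) r (by omega)
      have h3 : Tendsto (fun n => ∑ ab ∈ antidiagonal k, M n (ab.1 :: ab.2 :: r)) atTop
          (nhds (∑ ab ∈ antidiagonal k,
            ((ab.1 :: ab.2 :: r).map fun k => (semicircleMoment k : ℂ)).prod)) := by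
        refine tendsto_finsetSum _ fun ab hab => ?_
        rw [HasAntidiagonal.mem_antidiagonal] at hab
        exact ih (ab.1 :: ab.2 :: r).sum (by simp; omega) _ rfl
      have h4 := (h3.add h2).sub h1
      simp only [← hloop, add_sub_cancel_right] at h4
      convert! h4 using 2
      push_cast
      simp only [List.map_cons, List.prod_cons, Finset.sum_mul, mul_assoc]
  · push Not at hl
    have h1 : (fun n => M n l) = fun _ => 1 := by
      ext n
      clear hd
      induction l with
      | nil => exact hnil n
      | cons a l ihl =>
        rw [hl a (by simp), hzero]
        exact ihl fun b hb => hl b (by simp [hb])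
    have h2 : (l.map fun k => (semicircleMoment k : ℂ)).prod = 1 := by
      refine List.prod_eq_one fun x hx => ?_
      obtain ⟨a, ha, rfl⟩ := List.mem_map.1 hx
      rw [hl a ha, semicircleMoment_zero, Complex.ofReal_one]
    rw [h1, h2]
    exact tendsto_const_nhds

lemma integral_gaussWeight_pos [NeZero N] (μ : Measure (Herm N)) [μ.IsAddHaarMeasure] :
    0 < ∫ H, gaussWeight N H ∂μ := by
  have h := (integrable_entryEval_mul_gaussWeight NeZero.one_le μ 1).re
  simp only [map_one, one_mul] at h
  exact integral_exp_pos h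

/-- The Gaussian Dirac ensemble expectation of a polynomial in the matrix entries. -/
noncomputable def gaussExpectation [NeZero N] (μ : Measure (Herm N)) [μ.IsAddHaarMeasure] :
    MvPolynomial (Fin N × Fin N) ℂ →ₗ[ℂ] ℂ where
  toFun p := (∫ H, entryEval H p * (gaussWeight N H : ℂ) ∂μ) / (∫ H, gaussWeight N H ∂μ : ℝ)
  map_add' p q := by
    have hi := integrable_entryEval_mul_gaussWeight NeZero.one_le μ
    simp only [map_add, add_mul]
    rw [integral_add (hi p) (hi q), add_div]
  map_smul' c p := by
    have h (H : Herm N) : entryEval H (c • p) * (gaussWeight N H : ℂ) =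
        c * (entryEval H p * (gaussWeight N H : ℂ)) := by
      rw [entryEval, MvPolynomial.smul_eval, mul_assoc]
    simp only [h, integral_const_mul, RingHom.id_apply, smul_eq_mul, mul_div_assoc]

/-- The normalized trace `(1/N) tr H^k`. -/
noncomputable def normTracePow (N k : ℕ) : MvPolynomial (Fin N × Fin N) ℂ :=
  (N : ℂ)⁻¹ • tracePow N k

lemma powDeriv_normTracePow (k l : ℕ) : powDeriv N k (normTracePow N l) =
    (l : MvPolynomial (Fin N × Fin N) ℂ) * normTracePow N (k + l - 1) := by
  rw [normTracePow, Derivation.map_smul, powDeriv_tracePow, normTracePow, mul_smul_comm]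

lemma powDeriv_prod_normTracePow (k : ℕ) (l : List ℕ) :
    powDeriv N k (l.map (normTracePow N)).prod =
      mergeSum k (fun l' => (l'.map (normTracePow N)).prod) l := by
  induction l with
  | nil => simp [mergeSum]
  | cons a l ih =>
    simp only [List.map_cons, List.prod_cons, Derivation.leibniz, powDeriv_normTracePow, ih,
      smul_eq_mul, mergeSum, mul_mergeSum]
    ring

section Expectation

variable [NeZero N] (μ : Measure (Herm N)) [μ.IsAddHaarMeasure]

lemma gaussExpectation_one : gaussExpectation μ 1 = 1 := by
  have h : (∫ H, gaussWeight N H ∂μ : ℝ) ≠ 0 := (integral_gaussWeight_pos μ).ne'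
  change (∫ H, entryEval H 1 * (gaussWeight N H : ℂ) ∂μ) / (∫ H, gaussWeight N H ∂μ : ℝ) = 1
  simp only [map_one, one_mul, integral_complex_ofReal]
  exact div_self (Complex.ofReal_ne_zero.2 h)

lemma gaussExpectation_natCast_mul (n : ℕ) (p : MvPolynomial (Fin N × Fin N) ℂ) :
    gaussExpectation μ ((n : MvPolynomial (Fin N × Fin N) ℂ) * p) = n * gaussExpectation μ p := by
  rw [← nsmul_eq_mul, map_nsmul, nsmul_eq_mul]

lemma gaussExpectation_pderiv (q : Fin N × Fin N) (p : MvPolynomial (Fin N × Fin N) ℂ) :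
    gaussExpectation μ (MvPolynomial.pderiv q p) = gaussExpectation μ (potentialDeriv q * p) :=
  congrArg (· / ((∫ H, gaussWeight N H ∂μ : ℝ) : ℂ))
    (integral_pderiv_mul_gaussWeight NeZero.one_le μ p q)

/-- The Schwinger–Dyson equation. -/
lemma gaussExpectation_powDeriv (k : ℕ) (p : MvPolynomial (Fin N × Fin N) ℂ) :
    gaussExpectation μ ((∑ q : Fin N × Fin N, MvPolynomial.pderiv q
        ((Matrix.mvPolynomialX (Fin N) (Fin N) ℂ ^ k) q.1 q.2)) * p) +
      gaussExpectation μ (powDeriv N k p) =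
      gaussExpectation μ (((N : MvPolynomial (Fin N × Fin N) ℂ) * tracePow N (k + 1) +
        tracePow N 1 * tracePow N k) * p) := by
  rw [← sum_potentialDeriv_mul_mvPolynomialX_pow, powDeriv_apply, ← map_add, Finset.sum_mul,
    Finset.sum_mul, ← Finset.sum_add_distrib, map_sum, map_sum]
  refine Finset.sum_congr rfl fun q _ => ?_
  rw [mul_assoc, ← gaussExpectation_pderiv, MvPolynomial.pderiv_mul]

lemma tracePow_eq (k : ℕ) :
    tracePow N k = (N : MvPolynomial (Fin N × Fin N) ℂ) * normTracePow N k := by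
  have hN : (N : ℂ) ≠ 0 := NeZero.ne _
  have h : (N : MvPolynomial (Fin N × Fin N) ℂ) = MvPolynomial.C (N : ℂ) := by simp
  rw [normTracePow, h, ← MvPolynomial.smul_eq_C_mul, smul_smul, mul_inv_cancel₀ hN, one_smul]

lemma normTracePow_zero : normTracePow N 0 = 1 := by
  have hN : (N : ℂ) ≠ 0 := NeZero.ne _
  have h : tracePow N 0 = MvPolynomial.C (N : ℂ) := by simp [tracePow]
  rw [normTracePow, h, MvPolynomial.smul_eq_C_mul, ← map_mul, inv_mul_cancel₀ hN, map_one]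

lemma gaussExpectation_normTracePow_one (p : MvPolynomial (Fin N × Fin N) ℂ) :
    2 * gaussExpectation μ (normTracePow N 1 * p) =
      1 / (N : ℂ) ^ 2 * gaussExpectation μ (powDeriv N 0 p) := by
  have hN : (N : ℂ) ≠ 0 := NeZero.ne _
  have h := gaussExpectation_powDeriv μ 0 p
  have h0 : ∑ q : Fin N × Fin N, MvPolynomial.pderiv q
      ((Matrix.mvPolynomialX (Fin N) (Fin N) ℂ ^ 0) q.1 q.2) = 0 := by
    refine Finset.sum_eq_zero fun q _ => ?_
    rw [pow_zero, Matrix.one_apply]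
    split_ifs <;> simp
  have e : ((N : MvPolynomial (Fin N × Fin N) ℂ) * tracePow N (0 + 1) +
      tracePow N 1 * tracePow N 0) * p = (N : MvPolynomial (Fin N × Fin N) ℂ) *
        ((N : MvPolynomial (Fin N × Fin N) ℂ) *
          (((2 : ℕ) : MvPolynomial (Fin N × Fin N) ℂ) * (normTracePow N 1 * p))) := by
    rw [tracePow_eq, tracePow_eq, normTracePow_zero]
    push_cast
    ring
  rw [h0, zero_mul, map_zero, zero_add, e, gaussExpectation_natCast_mul,
    gaussExpectation_natCast_mul, gaussExpectation_natCast_mul] at h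
  rw [h]
  push_cast
  field_simp

lemma gaussExpectation_normTracePow_add_two (k : ℕ) (p : MvPolynomial (Fin N × Fin N) ℂ) :
    gaussExpectation μ (normTracePow N (k + 2) * p) +
      gaussExpectation μ (normTracePow N 1 * (normTracePow N (k + 1) * p)) =
      ∑ ab ∈ antidiagonal k,
        gaussExpectation μ (normTracePow N ab.1 * (normTracePow N ab.2 * p)) +
      1 / (N : ℂ) ^ 2 * gaussExpectation μ (powDeriv N (k + 1) p) := by
  have hN : (N : ℂ) ≠ 0 := NeZero.ne _
  have h := gaussExpectation_powDeriv μ (k + 1) p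
  have e1 : ((N : MvPolynomial (Fin N × Fin N) ℂ) * tracePow N (k + 1 + 1) +
      tracePow N 1 * tracePow N (k + 1)) * p = (N : MvPolynomial (Fin N × Fin N) ℂ) *
        ((N : MvPolynomial (Fin N × Fin N) ℂ) * (normTracePow N (k + 2) * p +
          normTracePow N 1 * (normTracePow N (k + 1) * p))) := by
    rw [tracePow_eq, tracePow_eq, tracePow_eq]
    ring
  have e2 : (∑ ab ∈ antidiagonal k, tracePow N ab.1 * tracePow N ab.2) * p =
      (N : MvPolynomial (Fin N × Fin N) ℂ) * ((N : MvPolynomial (Fin N × Fin N) ℂ) *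
        ∑ ab ∈ antidiagonal k, normTracePow N ab.1 * (normTracePow N ab.2 * p)) := by
    simp only [tracePow_eq, Finset.sum_mul, Finset.mul_sum]
    exact Finset.sum_congr rfl fun _ _ => by ring
  rw [sum_pderiv_mvPolynomialX_pow, e1, e2, gaussExpectation_natCast_mul,
    gaussExpectation_natCast_mul, gaussExpectation_natCast_mul,
    gaussExpectation_natCast_mul, map_add, map_sum] at h
  field_simp
  linear_combination -h

end Expectation

theorem tendsto_gaussExpectation_prod
    (μ : ∀ n : ℕ, Measure (Herm (n + 1))) [∀ n, (μ n).IsAddHaarMeasure] (l : List ℕ) :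
    Tendsto (fun n => gaussExpectation (μ n) (l.map (normTracePow (n + 1))).prod) atTop
      (nhds ((l.map fun k => (semicircleMoment k : ℂ)).prod)) := by
  refine tendsto_of_loop_equations
    (fun n l => gaussExpectation (μ n) (l.map (normTracePow (n + 1))).prod)
    (fun n => 1 / ((n + 1 : ℕ) : ℂ) ^ 2) ?_ ?_ ?_ ?_ ?_ ?_ l
  · have h := (tendsto_one_div_add_atTop_nhds_zero_nat (𝕜 := ℂ)).pow 2
    simpa using h
  · intro n
    simp [gaussExpectation_one]
  · intro n l
    simp [normTracePow_zero]
  · intro n l l' h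
    simp only [(h.map (normTracePow (n + 1))).prod_eq]
  · intro n l
    simp only [List.map_cons, List.prod_cons]
    rw [gaussExpectation_normTracePow_one, powDeriv_prod_normTracePow, map_mergeSum]
  · intro n k l
    simp only [List.map_cons, List.prod_cons]
    rw [gaussExpectation_normTracePow_add_two, powDeriv_prod_normTracePow, map_mergeSum]

lemma trace_diracOp_pow (H : Herm N) (m : ℕ) :
    Matrix.trace (diracOp N H ^ m) =
      ∑ j ∈ Finset.range (m + 1), (m.choose j : ℂ) *
        (Matrix.trace ((H : Matrix (Fin N) (Fin N) ℂ) ^ j) *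
          Matrix.trace ((H : Matrix (Fin N) (Fin N) ℂ) ^ (m - j))) := by
  set A : Matrix (Fin N) (Fin N) ℂ := (H : Matrix (Fin N) (Fin N) ℂ) with hA
  have hl (k : ℕ) : (A ⊗ₖ (1 : Matrix (Fin N) (Fin N) ℂ)) ^ k = (A ^ k) ⊗ₖ 1 := by
    induction k with
    | zero => simp
    | succ k ih => rw [pow_succ, ih, ← Matrix.mul_kronecker_mul, mul_one, pow_succ]
  have hr (k : ℕ) : ((1 : Matrix (Fin N) (Fin N) ℂ) ⊗ₖ Aᵀ) ^ k = 1 ⊗ₖ (A ^ k)ᵀ := by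
    induction k with
    | zero => simp
    | succ k ih =>
      rw [pow_succ, ih, ← Matrix.mul_kronecker_mul, mul_one, pow_succ', Matrix.transpose_mul]
  have hc : Commute (A ⊗ₖ (1 : Matrix (Fin N) (Fin N) ℂ))
      ((1 : Matrix (Fin N) (Fin N) ℂ) ⊗ₖ Aᵀ) := by
    rw [Commute, SemiconjBy, ← Matrix.mul_kronecker_mul, ← Matrix.mul_kronecker_mul]
    simp
  rw [diracOp, ← hA, hc.add_pow, Matrix.trace_sum]
  refine Finset.sum_congr rfl fun j _ => ?_
  rw [hl, hr, ← Matrix.mul_kronecker_mul, mul_one, one_mul, ← nsmul_eq_mul', Matrix.trace_smul,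
    Matrix.trace_kronecker, Matrix.trace_transpose, nsmul_eq_mul]

lemma normalized_moment_eq [NeZero N] (μ : Measure (Herm N)) [μ.IsAddHaarMeasure] (m : ℕ) :
    (1 / (N : ℝ) ^ 2) * ((∫ H, (Matrix.trace (diracOp N H ^ m)).re * gaussWeight N H ∂μ) /
        (∫ H, gaussWeight N H ∂μ)) =
      (∑ j ∈ Finset.range (m + 1), (m.choose j : ℂ) *
        gaussExpectation μ ([j, m - j].map (normTracePow N)).prod).re := by
  have hN : (N : ℂ) ≠ 0 := NeZero.ne _
  set P : MvPolynomial (Fin N × Fin N) ℂ := ∑ j ∈ Finset.range (m + 1),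
    (m.choose j : MvPolynomial (Fin N × Fin N) ℂ) * (tracePow N j * tracePow N (m - j)) with hP
  have h1 (H : Herm N) : (Matrix.trace (diracOp N H ^ m)).re * gaussWeight N H =
      (entryEval H P * (gaussWeight N H : ℂ)).re := by
    rw [Complex.re_mul_ofReal, trace_diracOp_pow, hP, map_sum]
    simp only [map_mul, map_natCast, entryEval_tracePow]
  have h2 : ∫ H, (entryEval H P * (gaussWeight N H : ℂ)).re ∂μ =
      (∫ H, entryEval H P * (gaussWeight N H : ℂ) ∂μ).re :=
    integral_re (integrable_entryEval_mul_gaussWeight NeZero.one_le μ P)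
  have h3 : ∑ j ∈ Finset.range (m + 1), (m.choose j : ℂ) *
      gaussExpectation μ ([j, m - j].map (normTracePow N)).prod =
      ((1 / (N : ℝ) ^ 2 : ℝ) : ℂ) * gaussExpectation μ P := by
    rw [hP, map_sum, Finset.mul_sum]
    refine Finset.sum_congr rfl fun j _ => ?_
    have e : tracePow N j * tracePow N (m - j) = (N : MvPolynomial (Fin N × Fin N) ℂ) *
        ((N : MvPolynomial (Fin N × Fin N) ℂ) *
          ([j, m - j].map (normTracePow N)).prod) := by
      simp only [tracePow_eq, List.map_cons, List.map_nil, List.prod_cons, List.prod_nil]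
      ring
    rw [e, gaussExpectation_natCast_mul, gaussExpectation_natCast_mul,
      gaussExpectation_natCast_mul]
    push_cast
    field_simp
  simp only [h1, h2]
  rw [h3, Complex.re_ofReal_mul]
  congr 1
  exact (Complex.div_ofReal_re _ _).symm

end GaussianDirac

/-- For the Gaussian Dirac ensemble of type (1,0), built over any additive Haar
(Lebesgue) measures on the real vector spaces of Hermitian matrices, the limiting
normalized moments of the Dirac operator `D_H = H ⊗ 1 + 1 ⊗ Hᵀ` are
`∑_{j=0}^m C(m,j) c_j c_{m−j}`. -/
theorem gaussian_dirac_ensemble_limiting_moments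
    (lam : ∀ N : ℕ, Measure (selfAdjoint (Matrix (Fin N) (Fin N) ℂ)))
    (hlam : ∀ N : ℕ, 1 ≤ N → (lam N).IsAddHaarMeasure) (m : ℕ) :
    Tendsto (fun N : ℕ =>
        (1 / (N : ℝ) ^ 2) *
          ((∫ H, (Matrix.trace ((diracOp N H) ^ m)).re * gaussWeight N H ∂(lam N)) /
            (∫ H, gaussWeight N H ∂(lam N))))
      atTop
      (nhds (∑ j ∈ Finset.range (m + 1),
        (m.choose j : ℝ) * semicircleMoment j * semicircleMoment (m - j))) := by
  have inst (n : ℕ) : (lam (n + 1)).IsAddHaarMeasure := hlam (n + 1) n.succ_pos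
  rw [← tendsto_add_atTop_iff_nat 1]
  simp only [GaussianDirac.normalized_moment_eq]
  have h := tendsto_finsetSum (Finset.range (m + 1)) fun j _ =>
    (GaussianDirac.tendsto_gaussExpectation_prod (fun n => lam (n + 1)) [j, m - j]).const_mul
      (m.choose j : ℂ)
  convert! (Complex.continuous_re.tendsto _).comp h using 2
  rw [Complex.re_sum]
  refine Finset.sum_congr rfl fun j _ => ?_
  simp only [List.map_cons, List.map_nil, List.prod_cons, List.prod_nil, mul_one]
  norm_cast
  rw [mul_assoc]
end

section
/- For each N ≥ 1 let μ_N be a probability measure on the real vector space of N×N complex Hermitian matrices such that H ↦ tr(H^a) is integrable with respect to μ_N for every natural number a, and let μ be a compactly supported probability measure on ℝ with moments m_a = ∫ x^a dμ. Assume: (i) for every a, lim_{N→∞} (1/N)·E_{μ_N}[tr(H^a)] = m_a, and (ii) for all a, b, lim_{N→∞} (1/N²)·E_{μ_N}[tr(H^a)·tr(H^b)] = m_a·m_b. Then for the type (1,0) Dirac operator D_H = H ⊗ I_N + I_N ⊗ Hᵀ and every natural number m, lim_{N→∞} (1/N²)·E_{μ_N}[tr(D_H^m)] = ∫_ℝ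 x^m d(μ∗μ), where μ∗μ is the convolution of μ with itself (the pushforward of μ×μ under addition). -/
open MeasureTheory Matrix Kronecker Complex Filter

theorem Matrix.kronecker_pow_pow {n R : Type*} [Fintype n] [DecidableEq n] [CommSemiring R]
    (A B : Matrix n n R) (k : ℕ) : (A ⊗ₖ B) ^ k = (A ^ k) ⊗ₖ (B ^ k) := by
  induction k with
  | zero => simp
  | succ k ih => rw [pow_succ, ih, ← mul_kronecker_mul, ← pow_succ, ← pow_succ]

theorem Matrix.trace_anticommutator_pow {n R : Type*} [Fintype n] [DecidableEq n] [CommRing R]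
    (A : Matrix n n R) (m : ℕ) :
    ((A ⊗ₖ (1 : Matrix n n R) + (1 : Matrix n n R) ⊗ₖ Aᵀ) ^ m).trace =
      ∑ k ∈ Finset.range (m + 1), (A ^ k).trace * (A ^ (m - k)).trace * (m.choose k : R) := by
  have hc : Commute (A ⊗ₖ (1 : Matrix n n R)) ((1 : Matrix n n R) ⊗ₖ Aᵀ) := by
    rw [Commute, SemiconjBy, ← mul_kronecker_mul, ← mul_kronecker_mul]
    simp
  rw [hc.add_pow, trace_sum]
  refine Finset.sum_congr rfl fun k _ => ?_
  rw [kronecker_pow_pow, kronecker_pow_pow, ← mul_kronecker_mul, one_pow, one_pow, mul_one,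
    one_mul, ← transpose_pow, ← nsmul_eq_mul', trace_smul, trace_kronecker, trace_transpose,
    nsmul_eq_mul']

theorem Matrix.IsHermitian.trace_im_eq_zero {n : Type*} [Fintype n] {A : Matrix n n ℂ}
    (hA : A.IsHermitian) : A.trace.im = 0 := by
  have h := trace_conjTranspose A
  rw [hA.eq] at h
  exact Complex.conj_eq_iff_im.mp h.symm

theorem Matrix.IsHermitian.sq_trace_re_le {n : Type*} [Fintype n] [DecidableEq n]
    {A : Matrix n n ℂ} (hA : A.IsHermitian) :
    A.trace.re ^ 2 ≤ Fintype.card n * (A ^ 2).trace.re := by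
  have h1 : A.trace.re ^ 2 ≤ Fintype.card n * ∑ i, (A i i).re ^ 2 := by
    simpa [trace] using sq_sum_le_card_mul_sum_sq (s := Finset.univ) (f := fun i => (A i i).re)
  refine h1.trans (mul_le_mul_of_nonneg_left ?_ (Nat.cast_nonneg _))
  have h2 : (A ^ 2).trace.re = ∑ i, ∑ j, Complex.normSq (A i j) := by
    simp only [pow_two, trace, diag_apply, mul_apply, Complex.re_sum]
    refine Finset.sum_congr rfl fun i _ => Finset.sum_congr rfl fun j _ => ?_
    rw [← hA.apply j i, Complex.star_def, Complex.mul_conj, Complex.ofReal_re]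
  rw [h2]
  refine Finset.sum_le_sum fun i _ => ?_
  calc (A i i).re ^ 2 ≤ Complex.normSq (A i i) := by
        rw [Complex.normSq_apply]
        nlinarith [mul_self_nonneg (A i i).im]
    _ ≤ ∑ j, Complex.normSq (A i j) :=
        Finset.single_le_sum (f := fun j => Complex.normSq (A i j))
          (fun j _ => Complex.normSq_nonneg _) (Finset.mem_univ i)

theorem isHermitian_coe_pow {n : Type*} [Fintype n] [DecidableEq n]
    (H : selfAdjoint (Matrix n n ℂ)) (a : ℕ) : ((H : Matrix n n ℂ) ^ a).IsHermitian :=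
  IsSelfAdjoint.pow H.2 a

theorem re_trace_diracOp_pow (N : ℕ) (H : selfAdjoint (Matrix (Fin N) (Fin N) ℂ)) (m : ℕ) :
    ((diracOp N H) ^ m).trace.re =
      ∑ k ∈ Finset.range (m + 1), ((H : Matrix (Fin N) (Fin N) ℂ) ^ k).trace.re *
        ((H : Matrix (Fin N) (Fin N) ℂ) ^ (m - k)).trace.re * (m.choose k : ℝ) := by
  rw [diracOp, trace_anticommutator_pow, Complex.re_sum]
  refine Finset.sum_congr rfl fun k _ => ?_
  simp [Complex.mul_re, (isHermitian_coe_pow H _).trace_im_eq_zero]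

theorem integrable_trace_mul_trace (N : ℕ)
    (ν : Measure (selfAdjoint (Matrix (Fin N) (Fin N) ℂ)))
    (hint : ∀ a : ℕ, Integrable
      (fun H : selfAdjoint (Matrix (Fin N) (Fin N) ℂ) =>
        (Matrix.trace ((H : Matrix (Fin N) (Fin N) ℂ) ^ a)).re) ν) (a b : ℕ) :
    Integrable (fun H : selfAdjoint (Matrix (Fin N) (Fin N) ℂ) =>
      (Matrix.trace ((H : Matrix (Fin N) (Fin N) ℂ) ^ a)).re *
        (Matrix.trace ((H : Matrix (Fin N) (Fin N) ℂ) ^ b)).re) ν := by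
  have hL2 (c : ℕ) : MemLp (fun H : selfAdjoint (Matrix (Fin N) (Fin N) ℂ) =>
      (Matrix.trace ((H : Matrix (Fin N) (Fin N) ℂ) ^ c)).re) 2 ν := by
    rw [memLp_two_iff_integrable_sq (hint c).aestronglyMeasurable]
    refine ((hint (c * 2)).const_mul (N : ℝ)).mono' ((hint c).aestronglyMeasurable.pow 2)
      (Eventually.of_forall fun H => ?_)
    rw [Real.norm_of_nonneg (sq_nonneg _), pow_mul]
    simpa using (isHermitian_coe_pow H c).sq_trace_re_le
  exact (hL2 a).integrable_mul (hL2 b)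

theorem integrable_pow_of_isCompact {μ : Measure ℝ} [IsFiniteMeasure μ] {K : Set ℝ}
    (hK : IsCompact K) (hμK : μ Kᶜ = 0) (a : ℕ) : Integrable (fun x : ℝ => x ^ a) μ := by
  have h : IntegrableOn (fun x : ℝ => x ^ a) K μ :=
    (continuous_pow a).continuousOn.integrableOn_compact hK
  rwa [IntegrableOn, Measure.restrict_eq_self_of_ae_mem (mem_ae_iff.mpr hμK)] at h

theorem integral_pow_map_add {μ ν : Measure ℝ} [SFinite μ] [SFinite ν]
    (hμ : ∀ a : ℕ, Integrable (fun x : ℝ => x ^ a) μ)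
    (hν : ∀ a : ℕ, Integrable (fun x : ℝ => x ^ a) ν) (m : ℕ) :
    ∫ x : ℝ, x ^ m ∂(Measure.map (fun p : ℝ × ℝ => p.1 + p.2) (μ.prod ν)) =
      ∑ k ∈ Finset.range (m + 1),
        (∫ x : ℝ, x ^ k ∂μ) * (∫ x : ℝ, x ^ (m - k) ∂ν) * (m.choose k : ℝ) := by
  rw [integral_map (by fun_prop) (by fun_prop)]
  simp only [add_pow]
  rw [integral_finsetSum _ fun k _ => ((hμ k).mul_prod (hν (m - k))).mul_const _]
  refine Finset.sum_congr rfl fun k _ => ?_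
  rw [integral_mul_const, integral_prod_mul (fun x : ℝ => x ^ k) (fun x : ℝ => x ^ (m - k))]

/-- If the normalized matrix moments of random Hermitian ensembles `μ_N` converge to the
moments of a compactly supported probability measure `μ` on `ℝ`, with asymptotic
factorization of bitracial correlations, then the limiting normalized moments of the
type (1,0) Dirac operator `D_H = H ⊗ 1 + 1 ⊗ Hᵀ` are the moments of `μ ∗ μ`. -/
theorem dirac_anticommutator_moments_convolution
    (μN : ∀ N : ℕ, Measure (selfAdjoint (Matrix (Fin N) (Fin N) ℂ)))
    (hprob : ∀ N : ℕ, IsProbabilityMeasure (μN N))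
    (hint : ∀ N a : ℕ, Integrable
      (fun H : selfAdjoint (Matrix (Fin N) (Fin N) ℂ) =>
        (Matrix.trace ((H : Matrix (Fin N) (Fin N) ℂ) ^ a)).re) (μN N))
    (μ : Measure ℝ) (hμprob : IsProbabilityMeasure μ)
    (hμcompact : ∃ K : Set ℝ, IsCompact K ∧ μ Kᶜ = 0)
    (hmom : ∀ a : ℕ, Tendsto (fun N : ℕ =>
        (1 / (N : ℝ)) *
          ∫ H, (Matrix.trace ((H : Matrix (Fin N) (Fin N) ℂ) ^ a)).re ∂(μN N))
      atTop (nhds (∫ x : ℝ, x ^ a ∂μ)))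
    (hfact : ∀ a b : ℕ, Tendsto (fun N : ℕ =>
        (1 / (N : ℝ) ^ 2) *
          ∫ H, (Matrix.trace ((H : Matrix (Fin N) (Fin N) ℂ) ^ a)).re *
            (Matrix.trace ((H : Matrix (Fin N) (Fin N) ℂ) ^ b)).re ∂(μN N))
      atTop (nhds ((∫ x : ℝ, x ^ a ∂μ) * (∫ x : ℝ, x ^ b ∂μ))))
    (m : ℕ) :
    Tendsto (fun N : ℕ =>
        (1 / (N : ℝ) ^ 2) *
          ∫ H, (Matrix.trace ((diracOp N H) ^ m)).re ∂(μN N))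
      atTop
      (nhds (∫ x : ℝ, x ^ m
        ∂(Measure.map (fun p : ℝ × ℝ => p.1 + p.2) (μ.prod μ)))) := by
  obtain ⟨K, hK, hμK⟩ := hμcompact
  have hμint := integrable_pow_of_isCompact hK hμK
  rw [integral_pow_map_add hμint hμint]
  have hE (N : ℕ) : (1 / (N : ℝ) ^ 2) * ∫ H, (Matrix.trace ((diracOp N H) ^ m)).re ∂(μN N) =
      ∑ k ∈ Finset.range (m + 1), (1 / (N : ℝ) ^ 2) *
        (∫ H, (Matrix.trace ((H : Matrix (Fin N) (Fin N) ℂ) ^ k)).re *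
          (Matrix.trace ((H : Matrix (Fin N) (Fin N) ℂ) ^ (m - k))).re ∂(μN N)) *
        (m.choose k : ℝ) := by
    simp only [re_trace_diracOp_pow]
    rw [integral_finsetSum _ fun k _ =>
      (integrable_trace_mul_trace N (μN N) (hint N) k (m - k)).mul_const _, Finset.mul_sum]
    exact Finset.sum_congr rfl fun k _ => by rw [integral_mul_const, mul_assoc]
  simp only [hE]
  exact tendsto_finsetSum _ fun k _ => (hfact k (m - k)).mul_const _
end

section
/- For each N ≥ 1 let μ_N be a probability measure on the real vector space of N×N complex Hermitian matrices such that H ↦ tr(H^a) is integrable with respect to μ_N for every natural number a, and let μ be a compactly supported probability measure on ℝ with moments m_a = ∫ x^a dμ that is symmetric (invariant under the pushforward of x ↦ −x). Assume: (i) for every a, lim_{N→∞} (1/N)·E_{μ_N}[tr(H^a)] = m_a, and (ii) for all a, b, lim_{N→∞} (1/N²)·E_{μ_N}[tr(H^a)·tr(H^b)] = m_a·m_b. Then for the commutator-type Dirac operator D_H = H ⊗ I_N − I_N ⊗ Hᵀ and every natural number m, lim_{N→∞} (1/N²)·E_{μ_N}[tr(D_H^m)] = ∫_ℝ x^m d(μ∗μ),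 where μ∗μ is the convolution of μ with itself. -/
open MeasureTheory Matrix Kronecker Complex Filter

/-- The commutator-type Dirac operator `D_H = H ⊗ I_N − I_N ⊗ Hᵀ`. -/
noncomputable def diracOpComm (N : ℕ) (H : selfAdjoint (Matrix (Fin N) (Fin N) ℂ)) :
    Matrix ((Fin N) × (Fin N)) ((Fin N) × (Fin N)) ℂ :=
  (H : Matrix (Fin N) (Fin N) ℂ) ⊗ₖ (1 : Matrix (Fin N) (Fin N) ℂ) -
    (1 : Matrix (Fin N) (Fin N) ℂ) ⊗ₖ (H : Matrix (Fin N) (Fin N) ℂ)ᵀ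

lemma trace_pow_im_eq_zero {N : ℕ} (H : selfAdjoint (Matrix (Fin N) (Fin N) ℂ)) (a : ℕ) :
    (trace ((H : Matrix (Fin N) (Fin N) ℂ) ^ a)).im = 0 := by
  have h : star ((H : Matrix (Fin N) (Fin N) ℂ) ^ a) = (H : Matrix (Fin N) (Fin N) ℂ) ^ a := by
    rw [star_pow, H.2.star_eq]
  rw [← Complex.conj_eq_iff_im]
  conv_rhs => rw [← h, star_eq_conjTranspose, trace_conjTranspose]
  rfl

/-- Cauchy–Schwarz for the trace of a Hermitian matrix. -/
lemma sq_re_trace_le_card_mul_re_trace_sq {n : Type*} [Fintype n] (A : Matrix n n ℂ)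
    (hA : A.IsHermitian) :
    (trace A).re ^ 2 ≤ Fintype.card n * (trace (A * A)).re := by
  have h1 : (trace (A * A)).re = ∑ i, ∑ j, Complex.normSq (A i j) := by
    simp only [trace, diag_apply, mul_apply, Complex.re_sum]
    refine Finset.sum_congr rfl fun i _ => Finset.sum_congr rfl fun j _ => ?_
    rw [← hA.apply j i, Complex.star_def, Complex.mul_conj, Complex.ofReal_re]
  have h2 : (trace A).re ^ 2 ≤ Fintype.card n * ∑ i, (A i i).re ^ 2 := by
    simpa [trace, Complex.re_sum] using
      sq_sum_le_card_mul_sum_sq (s := Finset.univ) (f := fun i => (A i i).re)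
  refine h2.trans (mul_le_mul_of_nonneg_left ?_ (Nat.cast_nonneg _))
  rw [h1]
  refine Finset.sum_le_sum fun i _ => ?_
  calc (A i i).re ^ 2 ≤ Complex.normSq (A i i) := by
        rw [Complex.normSq_apply]; nlinarith [mul_self_nonneg (A i i).im]
    _ ≤ ∑ j, Complex.normSq (A i j) :=
        Finset.single_le_sum (f := fun j => Complex.normSq (A i j))
          (fun j _ => Complex.normSq_nonneg _) (Finset.mem_univ i)

lemma trace_diracOpComm_pow {N : ℕ} (H : selfAdjoint (Matrix (Fin N) (Fin N) ℂ)) (m : ℕ) :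
    trace (diracOpComm N H ^ m) = ∑ k ∈ Finset.range (m + 1),
      (m.choose k : ℂ) * (-1) ^ (m - k) * (trace ((H : Matrix (Fin N) (Fin N) ℂ) ^ k) *
        trace ((H : Matrix (Fin N) (Fin N) ℂ) ^ (m - k))) := by
  set A : Matrix (Fin N) (Fin N) ℂ := (H : Matrix (Fin N) (Fin N) ℂ)
  have hl : ∀ k : ℕ, (A ⊗ₖ (1 : Matrix (Fin N) (Fin N) ℂ)) ^ k = (A ^ k) ⊗ₖ 1 := fun k => by
    induction k with
    | zero => simp
    | succ k ih => rw [pow_succ, ih, ← mul_kronecker_mul, one_mul, ← pow_succ]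
  have hr : ∀ k : ℕ, ((1 : Matrix (Fin N) (Fin N) ℂ) ⊗ₖ Aᵀ) ^ k = 1 ⊗ₖ (A ^ k)ᵀ := fun k => by
    induction k with
    | zero => simp
    | succ k ih => rw [pow_succ, ih, ← mul_kronecker_mul, one_mul, pow_succ', transpose_mul]
  have hc : Commute (A ⊗ₖ (1 : Matrix (Fin N) (Fin N) ℂ))
      (-((1 : Matrix (Fin N) (Fin N) ℂ) ⊗ₖ Aᵀ)) := by
    refine Commute.neg_right ?_
    simp only [Commute, SemiconjBy, ← mul_kronecker_mul, one_mul, mul_one]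
  rw [diracOpComm, sub_eq_add_neg, hc.add_pow, trace_sum]
  refine Finset.sum_congr rfl fun k _ => ?_
  rw [← neg_one_smul ℂ, smul_pow, hl, hr, mul_smul_comm, ← mul_kronecker_mul, one_mul, mul_one,
    ← nsmul_eq_mul', trace_smul, trace_smul, trace_kronecker, trace_transpose, nsmul_eq_mul,
    smul_eq_mul, mul_assoc]

lemma re_trace_diracOpComm_pow {N : ℕ} (H : selfAdjoint (Matrix (Fin N) (Fin N) ℂ)) (m : ℕ) :
    (trace (diracOpComm N H ^ m)).re = ∑ k ∈ Finset.range (m + 1),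
      (m.choose k : ℝ) * (-1) ^ (m - k) * ((trace ((H : Matrix (Fin N) (Fin N) ℂ) ^ k)).re *
        (trace ((H : Matrix (Fin N) (Fin N) ℂ) ^ (m - k))).re) := by
  have h : ∀ a : ℕ, trace ((H : Matrix (Fin N) (Fin N) ℂ) ^ a) =
      ((trace ((H : Matrix (Fin N) (Fin N) ℂ) ^ a)).re : ℂ) := fun a =>
    Complex.ext rfl (by simp [trace_pow_im_eq_zero])
  rw [trace_diracOpComm_pow, Complex.re_sum]
  refine Finset.sum_congr rfl fun k _ => ?_
  rw [h k, h (m - k)]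
  norm_cast

lemma integrable_re_trace_pow_mul {N : ℕ}
    {ν : Measure (selfAdjoint (Matrix (Fin N) (Fin N) ℂ))}
    (hint : ∀ a : ℕ, Integrable (fun H : selfAdjoint (Matrix (Fin N) (Fin N) ℂ) =>
      (trace ((H : Matrix (Fin N) (Fin N) ℂ) ^ a)).re) ν) (a b : ℕ) :
    Integrable (fun H : selfAdjoint (Matrix (Fin N) (Fin N) ℂ) =>
      (trace ((H : Matrix (Fin N) (Fin N) ℂ) ^ a)).re *
        (trace ((H : Matrix (Fin N) (Fin N) ℂ) ^ b)).re) ν := by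
  have hsq : ∀ (H : selfAdjoint (Matrix (Fin N) (Fin N) ℂ)) (c : ℕ),
      (trace ((H : Matrix (Fin N) (Fin N) ℂ) ^ c)).re ^ 2 ≤
        N * (trace ((H : Matrix (Fin N) (Fin N) ℂ) ^ (c + c))).re := fun H c => by
    have := sq_re_trace_le_card_mul_re_trace_sq ((H : Matrix (Fin N) (Fin N) ℂ) ^ c)
      (IsHermitian.pow H.2 c)
    rwa [Fintype.card_fin, ← pow_add] at this
  refine (((hint (a + a)).const_mul (N : ℝ)).add ((hint (b + b)).const_mul (N : ℝ))).mono'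
    ((hint a).aestronglyMeasurable.mul (hint b).aestronglyMeasurable)
    (Eventually.of_forall fun H => ?_)
  have ha := hsq H a
  have hb := hsq H b
  simp only [Pi.add_apply, Real.norm_eq_abs]
  rw [abs_le]
  constructor <;> nlinarith [sq_nonneg ((trace ((H : Matrix (Fin N) (Fin N) ℂ) ^ a)).re +
    (trace ((H : Matrix (Fin N) (Fin N) ℂ) ^ b)).re), sq_nonneg
    ((trace ((H : Matrix (Fin N) (Fin N) ℂ) ^ a)).re -
    (trace ((H : Matrix (Fin N) (Fin N) ℂ) ^ b)).re),
    sq_nonneg (trace ((H : Matrix (Fin N) (Fin N) ℂ) ^ a)).re,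
    sq_nonneg (trace ((H : Matrix (Fin N) (Fin N) ℂ) ^ b)).re]

lemma integrable_pow_of_compact_support {μ : Measure ℝ} [IsFiniteMeasure μ]
    (hμ : ∃ K : Set ℝ, IsCompact K ∧ μ Kᶜ = 0) (a : ℕ) : Integrable (fun x : ℝ => x ^ a) μ := by
  obtain ⟨K, hK, h0⟩ := hμ
  obtain ⟨C, hC⟩ := hK.exists_bound_of_continuousOn (continuous_pow a).continuousOn
  refine Integrable.of_bound (continuous_pow a).aestronglyMeasurable C ?_
  have : ∀ᵐ x ∂μ, x ∈ K := h0
  filter_upwards [this] with x hx using hC x hx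

lemma neg_one_pow_mul_moment_of_symmetric {μ : Measure ℝ}
    (hμ : Measure.map (fun x : ℝ => -x) μ = μ) (a : ℕ) :
    (-1) ^ a * ∫ x, x ^ a ∂μ = ∫ x, x ^ a ∂μ := by
  conv_rhs => rw [← hμ, integral_map (by fun_prop) (by fun_prop)]
  rw [← integral_const_mul]
  exact integral_congr_ae (Eventually.of_forall fun x => (neg_pow x a).symm)

lemma integral_pow_map_add_prod {μ : Measure ℝ} [SFinite μ]
    (hμ : ∀ a : ℕ, Integrable (fun x : ℝ => x ^ a) μ) (m : ℕ) :
    ∫ x, x ^ m ∂(Measure.map (fun p : ℝ × ℝ => p.1 + p.2) (μ.prod μ)) =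
      ∑ k ∈ Finset.range (m + 1),
        (m.choose k : ℝ) * ((∫ x, x ^ k ∂μ) * ∫ x, x ^ (m - k) ∂μ) := by
  rw [integral_map (by fun_prop) (by fun_prop)]
  simp_rw [add_pow]
  rw [integral_finsetSum _ fun k _ => ((hμ k).mul_prod (hμ (m - k))).mul_const _]
  refine Finset.sum_congr rfl fun k _ => ?_
  rw [integral_mul_const, integral_prod_mul (fun x : ℝ => x ^ k) (fun x : ℝ => x ^ (m - k)),
    mul_comm]

/-- If the normalized matrix moments of random Hermitian ensembles `μ_N` converge to the
moments of a symmetric compactly supported probability measure `μ` on `ℝ`, with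
asymptotic factorization of bitracial correlations, then the limiting normalized
moments of the commutator-type Dirac operator `D_H = H ⊗ 1 − 1 ⊗ Hᵀ` are the moments
of `μ ∗ μ`. -/
theorem dirac_commutator_moments_convolution
    (μN : ∀ N : ℕ, Measure (selfAdjoint (Matrix (Fin N) (Fin N) ℂ)))
    (hprob : ∀ N : ℕ, IsProbabilityMeasure (μN N))
    (hint : ∀ N a : ℕ, Integrable
      (fun H : selfAdjoint (Matrix (Fin N) (Fin N) ℂ) =>
        (Matrix.trace ((H : Matrix (Fin N) (Fin N) ℂ) ^ a)).re) (μN N))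
    (μ : Measure ℝ) (hμprob : IsProbabilityMeasure μ)
    (hμcompact : ∃ K : Set ℝ, IsCompact K ∧ μ Kᶜ = 0)
    (hμsymm : Measure.map (fun x : ℝ => -x) μ = μ)
    (hmom : ∀ a : ℕ, Tendsto (fun N : ℕ =>
        (1 / (N : ℝ)) *
          ∫ H, (Matrix.trace ((H : Matrix (Fin N) (Fin N) ℂ) ^ a)).re ∂(μN N))
      atTop (nhds (∫ x : ℝ, x ^ a ∂μ)))
    (hfact : ∀ a b : ℕ, Tendsto (fun N : ℕ =>
        (1 / (N : ℝ) ^ 2) *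
          ∫ H, (Matrix.trace ((H : Matrix (Fin N) (Fin N) ℂ) ^ a)).re *
            (Matrix.trace ((H : Matrix (Fin N) (Fin N) ℂ) ^ b)).re ∂(μN N))
      atTop (nhds ((∫ x : ℝ, x ^ a ∂μ) * (∫ x : ℝ, x ^ b ∂μ))))
    (m : ℕ) :
    Tendsto (fun N : ℕ =>
        (1 / (N : ℝ) ^ 2) *
          ∫ H, (Matrix.trace ((diracOpComm N H) ^ m)).re ∂(μN N))
      atTop
      (nhds (∫ x : ℝ, x ^ m
        ∂(Measure.map (fun p : ℝ × ℝ => p.1 + p.2) (μ.prod μ)))) := by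
  have hx := integrable_pow_of_compact_support hμcompact
  rw [integral_pow_map_add_prod hx]
  have hI := fun N => integrable_re_trace_pow_mul (hint N)
  have key : ∀ N : ℕ, (1 / (N : ℝ) ^ 2) * ∫ H, (Matrix.trace ((diracOpComm N H) ^ m)).re ∂(μN N) =
      ∑ k ∈ Finset.range (m + 1), (m.choose k : ℝ) * (-1) ^ (m - k) * ((1 / (N : ℝ) ^ 2) *
        ∫ H, (Matrix.trace ((H : Matrix (Fin N) (Fin N) ℂ) ^ k)).re *
            (Matrix.trace ((H : Matrix (Fin N) (Fin N) ℂ) ^ (m - k))).re ∂(μN N)) := fun N => by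
    simp_rw [re_trace_diracOpComm_pow]
    rw [integral_finsetSum _ fun k _ => (hI N k (m - k)).const_mul _, Finset.mul_sum]
    refine Finset.sum_congr rfl fun k _ => ?_
    rw [integral_const_mul]
    ring
  simp_rw [key]
  refine tendsto_finsetSum _ fun k _ => ?_
  convert (hfact k (m - k)).const_mul ((m.choose k : ℝ) * (-1) ^ (m - k)) using 2
  conv_lhs => rw [← neg_one_pow_mul_moment_of_symmetric hμsymm (m - k)]
  ring
end

section
/- For every x ∈ ℝ, the exponential moment generating function of the Wigner semicircle density satisfies ∫_{−2}^{2} e^{x·t} · (1/(2π))·√(4−t²) dt = ∑_{k=0}^{∞} x^{2k} / (k!·(k+1)!); equivalently, it equals I₁(2x)/x where I₁ is the modified Bessel function of the first kind given by the series I₁(y) = ∑_{k=0}^{∞} (1/(k!·(k+1)!))·(y/2)^{2k+1}. -/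
open MeasureTheory Real

/-- The modified Bessel function of the first kind `I₁`, defined by its
everywhere-convergent power series. -/
noncomputable def besselI1 (y : ℝ) : ℝ :=
  ∑' k : ℕ, (1 / ((k.factorial : ℝ) * ((k + 1).factorial : ℝ))) * (y / 2) ^ (2 * k + 1)

theorem integral_sqrt_four_sub_sq : ∫ t in (-2 : ℝ)..2, √(4 - t ^ 2) = 2 * π := by
  have h := intervalIntegral.mul_integral_comp_mul_left (a := (-1 : ℝ)) (b := 1)
    (f := fun t : ℝ => √(4 - t ^ 2)) 2
  have hs (u : ℝ) : √(4 - (2 * u) ^ 2) = 2 * √(1 - u ^ 2) := by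
    rw [show 4 - (2 * u) ^ 2 = 2 ^ 2 * (1 - u ^ 2) by ring,
      Real.sqrt_mul (by positivity), Real.sqrt_sq (by norm_num)]
  simp only [hs, intervalIntegral.integral_const_mul, integral_sqrt_one_sub_sq] at h
  norm_num at h
  linarith

theorem hasDerivAt_pow_mul_sqrt_four_sub_sq_pow_three (n : ℕ) {t : ℝ} (ht : 0 < 4 - t ^ 2) :
    HasDerivAt (fun t : ℝ => t ^ n * √(4 - t ^ 2) ^ 3)
      (4 * n * (t ^ (n - 1) * √(4 - t ^ 2)) - (n + 3) * (t ^ (n + 1) * √(4 - t ^ 2))) t := by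
  have h4 : HasDerivAt (fun t : ℝ => 4 - t ^ 2) (-(2 * t)) t := by
    simpa using (hasDerivAt_pow 2 t).const_sub 4
  refine ((hasDerivAt_pow n t).fun_mul ((h4.sqrt ht.ne').fun_pow 3)).congr_deriv ?_
  have hs : √(4 - t ^ 2) ≠ 0 := (Real.sqrt_pos.2 ht).ne'
  have hsq : √(4 - t ^ 2) ^ 2 = 4 - t ^ 2 := Real.sq_sqrt ht.le
  have hcube : √(4 - t ^ 2) ^ 3 = (4 - t ^ 2) * √(4 - t ^ 2) := by rw [pow_succ, hsq]
  rw [hcube]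
  rcases n with _ | n
  · field_simp
    simp
    ring
  · field_simp
    simp
    ring

theorem integral_pow_mul_sqrt_four_sub_sq_recurrence (n : ℕ) :
    4 * n * (∫ t in (-2 : ℝ)..2, t ^ (n - 1) * √(4 - t ^ 2)) =
      (n + 3) * ∫ t in (-2 : ℝ)..2, t ^ (n + 1) * √(4 - t ^ 2) := by
  have hci (c : ℝ) (m : ℕ) :
      IntervalIntegrable (fun t : ℝ => c * (t ^ m * √(4 - t ^ 2))) volume (-2) 2 :=
    Continuous.intervalIntegrable (by fun_prop) _ _
  have h := intervalIntegral.integral_eq_sub_of_hasDerivAt_of_le (a := (-2 : ℝ)) (b := 2)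
    (by norm_num)
    (Continuous.continuousOn (by fun_prop : Continuous fun t : ℝ => t ^ n * √(4 - t ^ 2) ^ 3))
    (fun t ht => hasDerivAt_pow_mul_sqrt_four_sub_sq_pow_three n (by nlinarith [ht.1, ht.2]))
    ((hci _ _).sub (hci _ _))
  rw [intervalIntegral.integral_sub (hci _ _) (hci _ _),
    intervalIntegral.integral_const_mul, intervalIntegral.integral_const_mul] at h
  norm_num at h
  linarith

theorem integral_odd_pow_mul_sqrt_four_sub_sq (k : ℕ) :
    ∫ t in (-2 : ℝ)..2, t ^ (2 * k + 1) * √(4 - t ^ 2) = 0 := by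
  induction k with
  | zero =>
    simpa using integral_pow_mul_sqrt_four_sub_sq_recurrence 0
  | succ k ih =>
    have h := integral_pow_mul_sqrt_four_sub_sq_recurrence (2 * k + 2)
    rw [show 2 * k + 2 - 1 = 2 * k + 1 by omega, ih, mul_zero] at h
    exact (mul_eq_zero.1 h.symm).resolve_left (by positivity)

theorem integral_even_pow_mul_sqrt_four_sub_sq (k : ℕ) :
    ∫ t in (-2 : ℝ)..2, t ^ (2 * k) * √(4 - t ^ 2) =
      2 * π * ((2 * k).factorial / (k.factorial * (k + 1).factorial)) := by
  induction k with
  | zero => simpa using integral_sqrt_four_sub_sq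
  | succ k ih =>
    have h := integral_pow_mul_sqrt_four_sub_sq_recurrence (2 * k + 1)
    rw [show 2 * k + 1 - 1 = 2 * k by omega, ih] at h
    rw [show 2 * (k + 1) = 2 * k + 1 + 1 by ring]
    have h0 : ((2 * k + 1 : ℕ) : ℝ) + 3 ≠ 0 := by positivity
    apply mul_left_cancel₀ h0
    rw [← h]
    simp only [Nat.factorial_succ]
    push_cast
    field_simp
    ring

theorem hasSum_integral_exp_mul_sqrt_four_sub_sq (x : ℝ) :
    HasSum (fun n : ℕ => x ^ n / n.factorial * ∫ t in (-2 : ℝ)..2, t ^ n * √(4 - t ^ 2))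
      (∫ t in (-2 : ℝ)..2, rexp (x * t) * √(4 - t ^ 2)) := by
  simp only [← intervalIntegral.integral_const_mul]
  have hb : Summable fun n : ℕ => (2 * |x|) ^ n / n.factorial * 2 :=
    (Real.summable_pow_div_factorial _).mul_right 2
  refine intervalIntegral.hasSum_integral_of_dominated_convergence
    (fun n _ => (2 * |x|) ^ n / n.factorial * 2)
    (fun n => Continuous.aestronglyMeasurable (by fun_prop)) ?_
    (ae_of_all _ fun _ _ => hb) intervalIntegrable_const ?_
  · refine fun n => ae_of_all _ fun t ht => ?_
    rw [Set.uIoc_of_le (by norm_num)] at ht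
    have ht2 : |t| ≤ 2 := abs_le.2 ⟨ht.1.le, ht.2⟩
    have hs : √(4 - t ^ 2) ≤ 2 := Real.sqrt_le_iff.2 ⟨by norm_num, by nlinarith [sq_nonneg t]⟩
    rw [← mul_assoc, norm_mul, norm_mul, norm_div, norm_pow, norm_pow, Real.norm_natCast,
      Real.norm_eq_abs, Real.norm_eq_abs, Real.norm_of_nonneg (Real.sqrt_nonneg _),
      div_mul_eq_mul_div, ← mul_pow, mul_comm 2 |x|]
    gcongr
  · refine ae_of_all _ fun t _ => ?_
    have h : HasSum (fun n : ℕ => (x * t) ^ n / n.factorial) (rexp (x * t)) := by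
      rw [Real.exp_eq_exp_ℝ]
      exact NormedSpace.expSeries_div_hasSum_exp _
    convert! h.mul_right (√(4 - t ^ 2)) using 2 with n
    rw [mul_pow]
    ring

theorem hasSum_mgf_wigner_semicircle (x : ℝ) :
    HasSum (fun k : ℕ => x ^ (2 * k) / ((k.factorial : ℝ) * ((k + 1).factorial : ℝ)))
      (∫ t in (-2 : ℝ)..2, rexp (x * t) * ((1 / (2 * π)) * √(4 - t ^ 2))) := by
  simp only [mul_left_comm _ (1 / (2 * π)), intervalIntegral.integral_const_mul]
  have h := (hasSum_integral_exp_mul_sqrt_four_sub_sq x).mul_left (1 / (2 * π))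
  rw [← (mul_right_injective₀ (two_ne_zero' ℕ)).hasSum_iff] at h
  · convert! h using 2 with k
    simp only [Function.comp_apply, integral_even_pow_mul_sqrt_four_sub_sq]
    field_simp
  · intro n hn
    obtain ⟨k, rfl⟩ : Odd n := by
      rw [← Nat.not_even_iff_odd, even_iff_exists_two_mul]
      exact fun ⟨k, hk⟩ => hn ⟨k, hk.symm⟩
    rw [integral_odd_pow_mul_sqrt_four_sub_sq, mul_zero, mul_zero]

theorem besselI1_two_mul_div {x : ℝ} (hx : x ≠ 0) :
    besselI1 (2 * x) / x =
      ∑' k : ℕ, x ^ (2 * k) / ((k.factorial : ℝ) * ((k + 1).factorial : ℝ)) := by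
  rw [besselI1, ← tsum_div_const]
  refine tsum_congr fun k => ?_
  rw [mul_div_cancel_left₀ x two_ne_zero, pow_succ]
  field_simp

/-- The exponential moment generating function of the Wigner semicircle density:
`∫_{−2}^{2} e^{xt}(1/(2π))√(4−t²) dt = ∑_{k≥0} x^{2k}/(k!(k+1)!)`, which equals
`I₁(2x)/x` for `x ≠ 0`. -/
theorem mgf_wigner_semicircle (x : ℝ) :
    (∫ t in (-2 : ℝ)..2, Real.exp (x * t) * ((1 / (2 * π)) * Real.sqrt (4 - t ^ 2))) =
        ∑' k : ℕ, x ^ (2 * k) / ((k.factorial : ℝ) * ((k + 1).factorial : ℝ)) ∧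
    (x ≠ 0 →
      (∫ t in (-2 : ℝ)..2, Real.exp (x * t) * ((1 / (2 * π)) * Real.sqrt (4 - t ^ 2))) =
        besselI1 (2 * x) / x) := by
  have h := (hasSum_mgf_wigner_semicircle x).tsum_eq.symm
  exact ⟨h, fun hx => h.trans (besselI1_two_mul_div hx).symm⟩
end
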